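/- arXiv:1111.3911 — 3 statements merged into one kernel-verified Lean document; each statement's English description precedes it below -/
import Mathlib

section
/- For every pair of integers d ≥ 1 and 0 ≤ m ≤ d−1 there exists a constant f(d,m) > 0 with the following property. For every integer n ≥ 1 and every coloring χ of the lattice points of the cube {0,1,…,n}^d (i.e. a function χ : ({0,…,n})^d → Colors, for an arbitrary type Colors) such that every cubical (m+1)-dimensional face of the grid carries at most m+1 distinct colors on its 2^{m+1} vertices, some color c satisfies |χ⁻¹(c)| ≥ f(d,m) · n^{d−m}. -/
namespace CubeCol

open Finset

noncomputable section

/-- mod 2 cubical cochains on the grid `ℤ^d`; a face is a direction set and a base point. -/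
abbrev Cochain (d : ℕ) := Finset (Fin d) → (Fin d → ℤ) → ZMod 2

lemma sum_swap {α M : Type*} [DecidableEq α] [AddCommMonoid M] (S : Finset α) (f : α → α → M) :
    ∑ i ∈ S, ∑ j ∈ S.erase i, f i j = ∑ j ∈ S, ∑ i ∈ S.erase j, f i j := by
  apply Finset.sum_comm'
  intro x y
  simp only [mem_erase]
  tauto

lemma sum_symm_zero {α : Type*} [DecidableEq α] (S : Finset α) (f : α → α → ZMod 2)
    (hf : ∀ i j, f i j = f j i) :
    ∑ i ∈ S, ∑ j ∈ S.erase i, f i j = 0 := by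
  rw [Finset.sum_sigma']
  apply Finset.sum_involution (fun p _ => ⟨p.2, p.1⟩)
  · rintro ⟨i, j⟩ _
    simp only
    rw [hf j i]
    exact CharTwo.add_self_eq_zero _
  · rintro ⟨i, j⟩ h _ heq
    simp only [mem_sigma, mem_erase] at h
    simp only [Sigma.mk.injEq, heq_eq_eq] at heq
    exact h.2.1 heq.1
  · rintro ⟨i, j⟩ _
    rfl
  · rintro ⟨i, j⟩ h
    simp only [mem_sigma, mem_erase] at h ⊢
    exact ⟨h.2.2, fun hh => h.2.1 hh.symm, h.1⟩

/-- coboundary -/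
def delta {d : ℕ} (a : Cochain d) : Cochain d := fun S x =>
  ∑ i ∈ S, (a (S.erase i) (x + Pi.single i 1) + a (S.erase i) x)

lemma delta_add {d : ℕ} (a b : Cochain d) : delta (a + b) = delta a + delta b := by
  funext S x
  simp only [delta, Pi.add_apply]
  rw [← sum_add_distrib]
  exact sum_congr rfl fun i _ => by ring

lemma delta_zero {d : ℕ} : delta (0 : Cochain d) = 0 := by
  funext S x
  simp [delta]

lemma delta_sum {d : ℕ} {ι : Type*} (s : Finset ι) (f : ι → Cochain d) :
    delta (∑ i ∈ s, f i) = ∑ i ∈ s, delta (f i) := by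
  classical
  induction s using Finset.induction_on with
  | empty => simp [delta_zero]
  | insert a s ha ih => rw [sum_insert ha, sum_insert ha, delta_add, ih]

lemma delta_delta {d : ℕ} (a : Cochain d) : delta (delta a) = 0 := by
  funext S x
  simp only [delta, Pi.zero_apply]
  simp only [← sum_add_distrib]
  apply sum_symm_zero
  intro i j
  rw [Finset.erase_right_comm, add_right_comm x]
  ring

lemma cochain_add_self {d : ℕ} (a : Cochain d) : a + a = 0 := by
  funext S x
  exact CharTwo.add_self_eq_zero _

/-- sum over the edges between `p` and `x` -/
def seg (g : ℤ → ZMod 2) (p x : ℤ) : ZMod 2 := ∑ e ∈ Ico p x, g e + ∑ e ∈ Ico x p, g e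

lemma seg_succ (g : ℤ → ZMod 2) (p x : ℤ) : seg g p (x + 1) = seg g p x + g x := by
  unfold seg
  rcases le_or_gt p x with h | h
  · have h1 : Ico p (x + 1) = insert x (Ico p x) := by ext; simp; omega
    rw [h1, sum_insert (by simp), Ico_eq_empty_of_le h, Ico_eq_empty_of_le (by omega : p ≤ x + 1)]
    ring
  · have h1 : Ico x p = insert x (Ico (x + 1) p) := by ext; simp; omega
    rw [h1, sum_insert (by simp), Ico_eq_empty_of_le h.le,
      Ico_eq_empty_of_le (by omega : x + 1 ≤ p)]
    have := CharTwo.add_self_eq_zero (g x)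
    linear_combination -this

lemma seg_tele (u : ℤ → ZMod 2) (p x : ℤ) : seg (fun e => u (e + 1) + u e) p x = u x + u p := by
  induction x using Int.inductionOn' (b := p) with
  | zero => simp [seg, CharTwo.add_self_eq_zero]
  | succ k hk ih =>
    rw [seg_succ, ih]
    have := CharTwo.add_self_eq_zero (u k)
    linear_combination this
  | pred k hk ih =>
    have h := seg_succ (fun e => u (e + 1) + u e) p (k - 1)
    simp only [sub_add_cancel] at h
    rw [ih] at h
    have := CharTwo.add_self_eq_zero (u (k - 1))
    linear_combination -h - this

/-- partial contraction in direction `i` -/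
def hop {d : ℕ} (i : Fin d) (p : ℤ) (a : Cochain d) : Cochain d := fun S x =>
  if i ∈ S then 0 else seg (fun e => a (insert i S) (Function.update x i e)) p (x i)

/-- partial projection in direction `i` -/
def proj {d : ℕ} (i : Fin d) (p : ℤ) (a : Cochain d) : Cochain d := fun S x =>
  if i ∈ S then 0 else a S (Function.update x i p)

lemma upd_same {d : ℕ} (i : Fin d) (x : Fin d → ℤ) (e t : ℤ) :
    Function.update (x + Pi.single i t) i e = Function.update x i e := by
  funext j
  by_cases h : j = i
  · subst h; simp
  · simp [h]

lemma upd_ne {d : ℕ} {i j : Fin d} (hij : j ≠ i) (x : Fin d → ℤ) (e t : ℤ) :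
    Function.update (x + Pi.single j t) i e = Function.update x i e + Pi.single j t := by
  funext l
  by_cases h : l = i
  · subst h; simp [hij.symm]
  · simp [h]

lemma upd_succ {d : ℕ} (i : Fin d) (x : Fin d → ℤ) (e t : ℤ) :
    Function.update x i e + Pi.single i t = Function.update x i (e + t) := by
  funext l
  by_cases h : l = i
  · subst h; simp
  · simp [h]

lemma seg_add (f g : ℤ → ZMod 2) (p x : ℤ) : seg (fun e => f e + g e) p x = seg f p x + seg g p x := by
  simp only [seg, sum_add_distrib]; ring

lemma seg_sum {ι : Type*} (s : Finset ι) (f : ι → ℤ → ZMod 2) (p x : ℤ) :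
    seg (fun e => ∑ i ∈ s, f i e) p x = ∑ i ∈ s, seg (f i) p x := by
  simp only [seg, sum_add_distrib]
  rw [sum_comm, sum_comm (s := Ico x p)]

lemma homotopy {d : ℕ} (i : Fin d) (p : ℤ) (a : Cochain d) (ha : delta a = 0) :
    a = proj i p a + delta (hop i p a) := by
  funext S x
  simp only [Pi.add_apply]
  by_cases hi : i ∈ S
  · have h1 : delta (hop i p a) S x = a S x := by
      unfold delta
      rw [sum_eq_single_of_mem i hi]
      · simp only [hop, notMem_erase, if_false, upd_same, insert_erase hi, Pi.add_apply,
          Pi.single_eq_same, seg_succ, Function.update_eq_self]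
        have := CharTwo.add_self_eq_zero
          (seg (fun e => a S (Function.update x i e)) p (x i))
        linear_combination this
      · intro j hj hji
        have : i ∈ S.erase j := mem_erase.2 ⟨hji.symm, hi⟩
        simp [hop, this]
    rw [h1]
    simp [proj, hi]
  · have key : ∀ e, ∑ j ∈ S, (a ((insert i S).erase j) (Function.update x i e + Pi.single j 1)
        + a ((insert i S).erase j) (Function.update x i e)) =
        a S (Function.update x i (e + 1)) + a S (Function.update x i e) := by
      intro e
      have h := congrFun (congrFun ha (insert i S)) (Function.update x i e)
      simp only [delta, Pi.zero_apply] at h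
      rw [sum_insert hi, erase_insert hi, upd_succ] at h
      have h2 := CharTwo.add_self_eq_zero
        (a S (Function.update x i (e + 1)) + a S (Function.update x i e))
      linear_combination h - h2
    have h1 : delta (hop i p a) S x = a S x + a S (Function.update x i p) := by
      have h3 := seg_tele (fun e => a S (Function.update x i e)) p (x i)
      simp only [Function.update_eq_self] at h3
      rw [← h3]
      simp only [← key]
      rw [seg_sum]
      unfold delta
      apply sum_congr rfl
      intro j hj
      have hji : j ≠ i := fun h => hi (h ▸ hj)
      have hie : i ∉ S.erase j := fun h => hi (mem_of_mem_erase h)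
      rw [seg_add]
      simp only [hop, hie, if_false, upd_ne hji, erase_insert_of_ne hji.symm]
      simp [hji.symm]
    rw [h1]
    simp only [proj, hi, if_false]
    have := CharTwo.add_self_eq_zero (a S (Function.update x i p))
    linear_combination -this

lemma delta_proj {d : ℕ} (i : Fin d) (p : ℤ) (a : Cochain d) (ha : delta a = 0) :
    delta (proj i p a) = 0 := by
  have h := congrArg delta (homotopy i p a ha)
  rw [delta_add, delta_delta, ha, add_zero] at h
  exact h.symm

/-- the half open box -/
def box (d n : ℕ) : Finset (Fin d → ℤ) := Fintype.piFinset fun _ => Ico (0 : ℤ) n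

lemma mem_box {d n : ℕ} {x : Fin d → ℤ} : x ∈ box d n ↔ ∀ i, 0 ≤ x i ∧ x i < n := by
  simp [box]

/-- support in the box -/
def supp {d : ℕ} (n : ℕ) (a : Cochain d) : Finset (Finset (Fin d) × (Fin d → ℤ)) :=
  ((univ : Finset (Finset (Fin d))) ×ˢ box d n).filter fun q => a q.1 q.2 ≠ 0

lemma mem_supp {d n : ℕ} {a : Cochain d} {q : Finset (Fin d) × (Fin d → ℤ)} :
    q ∈ supp n a ↔ q.2 ∈ box d n ∧ a q.1 q.2 ≠ 0 := by
  simp [supp]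

/-- number of faces in the support -/
def size {d : ℕ} (n : ℕ) (a : Cochain d) : ℕ := (supp n a).card

lemma size_zero {d : ℕ} (n : ℕ) : size n (0 : Cochain d) = 0 := by
  simp [size, supp]

lemma size_add {d : ℕ} (n : ℕ) (a b : Cochain d) : size n (a + b) ≤ size n a + size n b := by
  refine le_trans (card_le_card ?_) (card_union_le _ _)
  intro q hq
  rw [mem_union, mem_supp, mem_supp]
  rw [mem_supp] at hq
  by_contra hcon
  push Not at hcon
  apply hq.2
  simp [hcon.1 hq.1, hcon.2 hq.1]

lemma size_sum {d : ℕ} (n : ℕ) {ι : Type*} (s : Finset ι) (f : ι → Cochain d) :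
    size n (∑ i ∈ s, f i) ≤ ∑ i ∈ s, size n (f i) := by
  classical
  induction s using Finset.induction_on with
  | empty => simp [size_zero]
  | insert a s ha ih =>
    rw [sum_insert ha, sum_insert ha]
    exact (size_add _ _ _).trans (by omega)

lemma upd_mem_box {d n : ℕ} {x : Fin d → ℤ} (hx : x ∈ box d n) (i : Fin d) {e : ℤ}
    (he : 0 ≤ e ∧ e < n) : Function.update x i e ∈ box d n := by
  rw [mem_box] at *
  intro j
  by_cases h : j = i
  · subst h; simpa using he
  · simpa [h] using hx j

lemma size_hop {d n : ℕ} (i : Fin d) {p : ℤ} (hp : 0 ≤ p ∧ p < n) (a : Cochain d) :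
    size n (hop i p a) ≤ n * size n a := by
  have hsub : supp n (hop i p a) ⊆ ((Ico (0 : ℤ) n) ×ˢ supp n a).image
      (fun r => (r.2.1.erase i, Function.update r.2.2 i r.1)) := by
    rintro ⟨S, x⟩ hq
    rw [mem_supp] at hq
    obtain ⟨hx, hne⟩ := hq
    simp only [hop] at hne hx
    split_ifs at hne with hi
    · exact absurd rfl hne
    have hxi := mem_box.1 hx i
    have hex : ∃ e : ℤ, (0 ≤ e ∧ e < n) ∧ a (insert i S) (Function.update x i e) ≠ 0 := by
      by_contra hcon
      push Not at hcon
      apply hne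
      unfold seg
      rw [sum_eq_zero, sum_eq_zero, add_zero]
      · intro e he
        rw [mem_Ico] at he
        exact hcon e ⟨by omega, by omega⟩
      · intro e he
        rw [mem_Ico] at he
        exact hcon e ⟨by omega, by omega⟩
    obtain ⟨e, he, hae⟩ := hex
    rw [mem_image]
    refine ⟨(x i, (insert i S, Function.update x i e)), ?_, ?_⟩
    · rw [mem_product, mem_supp, mem_Ico]
      exact ⟨hxi, upd_mem_box hx i he, hae⟩
    · simp [erase_insert hi]
  refine (card_le_card hsub).trans (card_image_le.trans ?_)
  simp [card_product, size]

lemma exists_proj {d n : ℕ} (hn : 1 ≤ n) (i : Fin d) (a : Cochain d) :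
    ∃ p : ℤ, (0 ≤ p ∧ p < n) ∧ size n (proj i p a) ≤ size n a := by
  have h : ∑ p ∈ Ico (0 : ℤ) n, size n (proj i p a) ≤ ∑ p ∈ Ico (0 : ℤ) n, size n a := by
    simp only [size]
    rw [← card_sigma, sum_const, Int.card_Ico, smul_eq_mul]
    have : ((n : ℤ) - 0).toNat * (supp n a).card = ((Ico (0 : ℤ) n) ×ˢ supp n a).card := by
      simp
    rw [this]
    apply card_le_card_of_injOn (fun r => (r.2.2 i, (r.2.1, Function.update r.2.2 i r.1)))
    · rintro ⟨p, S, x⟩ hr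
      simp only [coe_sigma, Set.mem_sigma_iff, mem_coe, mem_Ico, mem_supp, proj] at hr
      obtain ⟨hp, hx, hne⟩ := hr
      split_ifs at hne with hi
      · exact absurd rfl hne
      simp only [mem_coe, mem_product, mem_supp, mem_Ico]
      exact ⟨mem_box.1 hx i, upd_mem_box hx i hp, hne⟩
    · rintro ⟨p, S, x⟩ _ ⟨p', S', x'⟩ _ heq
      simp only [Prod.mk.injEq] at heq
      obtain ⟨h1, h2, h3⟩ := heq
      have hp : p = p' := by simpa using congrFun h3 i
      have hx : x = x' := by
        funext j
        by_cases hj : j = i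
        · subst hj; exact h1
        · simpa [hj] using congrFun h3 j
      subst hp h2 hx
      rfl
  obtain ⟨p, hp, hle⟩ := exists_le_of_sum_le (by simp; omega) h
  exact ⟨p, mem_Ico.1 hp, hle⟩

lemma fill_aux {d n : ℕ} (hn : 1 ≤ n) (k : ℕ) (a : Cochain d)
    (hk : ∀ S x, a S x ≠ 0 → S.card = k + 1) (ha : delta a = 0) (T : Finset (Fin d)) :
    ∃ a' b : Cochain d, a = a' + delta b ∧ delta a' = 0 ∧
      (∀ S x, a' S x ≠ 0 → S.card = k + 1 ∧ Disjoint S T) ∧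
      (∀ S x, b S x ≠ 0 → S.card = k) ∧ size n a' ≤ size n a ∧
      size n b ≤ T.card * (n * size n a) := by
  induction T using Finset.induction_on with
  | empty =>
    refine ⟨a, 0, by simp [delta_zero], ha, fun S x h => ⟨hk S x h, by simp⟩, by simp, le_rfl, ?_⟩
    simp [size_zero]
  | insert i T hi ih =>
    obtain ⟨a', b, h1, h2, h3, h4, h5, h6⟩ := ih
    obtain ⟨p, hp, hpa⟩ := exists_proj hn i a'
    refine ⟨proj i p a', b + hop i p a', ?_, delta_proj i p a' h2, ?_, ?_, hpa.trans h5, ?_⟩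
    · rw [delta_add]
      conv_lhs => rw [h1, homotopy i p a' h2]
      abel
    · intro S x hne
      simp only [proj] at hne
      split_ifs at hne with hiS
      · exact absurd rfl hne
      have := h3 _ _ hne
      exact ⟨this.1, disjoint_insert_right.2 ⟨hiS, this.2⟩⟩
    · intro S x hne
      by_cases hb : b S x = 0
      · have hne' : hop i p a' S x ≠ 0 := by simpa [hb] using hne
        simp only [hop] at hne'
        split_ifs at hne' with hiS
        · exact absurd rfl hne'
        have : ∃ e, a' (insert i S) (Function.update x i e) ≠ 0 := by
          by_contra hcon
          push Not at hcon
          exact hne' (by simp [seg, hcon])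
        obtain ⟨e, he⟩ := this
        have := (h3 _ _ he).1
        rw [card_insert_of_notMem hiS] at this
        omega
      · exact h4 _ _ hb
    · rw [card_insert_of_notMem hi]
      calc size n (b + hop i p a') ≤ size n b + size n (hop i p a') := size_add _ _ _
        _ ≤ T.card * (n * size n a) + n * size n a :=
            add_le_add h6 ((size_hop i hp a').trans (Nat.mul_le_mul_left _ h5))
        _ = _ := by ring

lemma fill {d n : ℕ} (hn : 1 ≤ n) (k : ℕ) (a : Cochain d)
    (hk : ∀ S x, a S x ≠ 0 → S.card = k + 1) (ha : delta a = 0) :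
    ∃ b : Cochain d, delta b = a ∧ (∀ S x, b S x ≠ 0 → S.card = k) ∧
      size n b ≤ d * (n * size n a) := by
  obtain ⟨a', b, h1, h2, h3, h4, h5, h6⟩ := fill_aux hn k a hk ha univ
  have h0 : a' = 0 := by
    funext S x
    by_contra hne
    have := h3 S x hne
    have hS : S = ∅ := by
      have := this.2
      rw [disjoint_left] at this
      exact eq_empty_of_forall_notMem fun x hx => this hx (mem_univ x)
    simp [hS] at this
  refine ⟨b, by rw [h1, h0, zero_add], h4, by simpa using h6⟩

section colors

variable {C : Type*} [Fintype C] [DecidableEq C]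

/-- cone of a chain of simplices with apex `v` -/
def cone (v : C) (c : Finset C → ZMod 2) : Finset C → ZMod 2 := fun τ =>
  if v ∈ τ then c (τ.erase v) else 0

/-- boundary of a chain of simplices -/
def bd (c : Finset C → ZMod 2) : Finset C → ZMod 2 := fun τ =>
  ∑ w ∈ τᶜ, c (insert w τ)

lemma cone_sum {ι : Type*} (v : C) (s : Finset ι) (f : ι → Finset C → ZMod 2) :
    cone v (∑ i ∈ s, f i) = ∑ i ∈ s, cone v (f i) := by
  funext τ
  simp only [cone, Finset.sum_apply]
  split_ifs <;> simp

lemma bd_sum {ι : Type*} (s : Finset ι) (f : ι → Finset C → ZMod 2) :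
    bd (∑ i ∈ s, f i) = ∑ i ∈ s, bd (f i) := by
  funext τ
  simp only [bd, Finset.sum_apply]
  rw [sum_comm]

lemma bd_cone (v : C) (c : Finset C → ZMod 2) : bd (cone v c) = c + cone v (bd c) := by
  funext τ
  simp only [Pi.add_apply]
  by_cases hv : v ∈ τ
  · simp only [bd, cone, hv, if_true, mem_insert, or_true]
    have h1 : (τ.erase v)ᶜ = insert v τᶜ := by
      ext w; simp only [mem_compl, mem_erase, mem_insert]; tauto
    rw [h1, sum_insert (by simp [hv]), insert_erase hv]
    have h2 : ∑ x ∈ τᶜ, c ((insert x τ).erase v) = ∑ x ∈ τᶜ, c (insert x (τ.erase v)) := by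
      apply sum_congr rfl
      intro x hx
      rw [erase_insert_of_ne]
      rintro rfl
      simp [hv] at hx
    rw [h2]
    have := CharTwo.add_self_eq_zero (c τ)
    linear_combination -this
  · simp only [bd, cone, hv, if_false, add_zero]
    rw [sum_eq_single_of_mem v (by simp [hv])]
    · simp [hv]
    · intro w _ hwv
      rw [if_neg]
      simp [hv, hwv.symm]

variable {d : ℕ} (χ : (Fin d → ℤ) → C)

/-- The chain of simplices attached to a face by the Kuhn triangulation. -/
def kuhn : ℕ → Finset (Fin d) → (Fin d → ℤ) → Finset C → ZMod 2
  | 0, _, x => fun σ => if σ = {χ x} then 1 else 0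
  | k + 1, S, x => cone (χ x) (∑ i ∈ S, kuhn k (S.erase i) (x + Pi.single i 1))

lemma bd_kuhn_zero (S : Finset (Fin d)) (x : Fin d → ℤ) (τ : Finset C) :
    bd (kuhn χ 0 S x) τ = if τ = ∅ then 1 else 0 := by
  simp only [bd, kuhn]
  split_ifs with h
  · subst h
    rw [sum_eq_single_of_mem (χ x) (by simp)]
    · simp
    · intro w _ hw
      simp [hw]
  · apply sum_eq_zero
    intro w hw
    rw [if_neg]
    intro heq
    apply h
    rw [mem_compl] at hw
    have h1 : τ ⊆ {χ x} := heq ▸ subset_insert w τ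
    rcases subset_singleton_iff.1 h1 with h2 | h2
    · exact h2
    · have : w ∈ ({χ x} : Finset C) := heq ▸ mem_insert_self w τ
      exact absurd (h2 ▸ this) hw

lemma bd_kuhn (k : ℕ) : ∀ (S : Finset (Fin d)) (x : Fin d → ℤ), S.card = k + 1 →
    bd (kuhn χ (k + 1) S x) =
      ∑ i ∈ S, (kuhn χ k (S.erase i) (x + Pi.single i 1) + kuhn χ k (S.erase i) x) := by
  induction k with
  | zero =>
    intro S x hS
    obtain ⟨i, rfl⟩ := card_eq_one.1 hS
    rw [kuhn, bd_cone]
    simp only [sum_singleton]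
    congr 1
    funext τ
    simp only [cone, bd_kuhn_zero]
    simp only [kuhn]
    by_cases h : χ x ∈ τ
    · simp only [h, if_true]
      congr 1
      simp only [erase_eq_empty_iff, eq_iff_iff]
      constructor
      · rintro (h1 | h1)
        · simp [h1] at h
        · exact h1
      · exact Or.inr
    · rw [if_neg h, if_neg]
      rintro rfl
      simp at h
  | succ k ih =>
    intro S x hS
    rw [kuhn, bd_cone, sum_add_distrib, bd_sum]
    congr 1
    have h1 : ∑ i ∈ S, bd (kuhn χ (k + 1) (S.erase i) (x + Pi.single i 1)) =
        ∑ i ∈ S, ∑ j ∈ S.erase i, kuhn χ k ((S.erase i).erase j) (x + Pi.single j 1) := by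
      have h2 : ∀ i ∈ S, bd (kuhn χ (k + 1) (S.erase i) (x + Pi.single i 1)) =
          ∑ j ∈ S.erase i, kuhn χ k ((S.erase i).erase j) (x + Pi.single i 1 + Pi.single j 1) +
          ∑ j ∈ S.erase i, kuhn χ k ((S.erase i).erase j) (x + Pi.single i 1) := by
        intro i hi
        rw [ih _ _ (by rw [card_erase_of_mem hi]; omega), sum_add_distrib]
      rw [sum_congr rfl h2, sum_add_distrib]
      have h3 : ∑ i ∈ S, ∑ j ∈ S.erase i,
          kuhn χ k ((S.erase i).erase j) (x + Pi.single i 1 + Pi.single j 1) = 0 := by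
        funext τ
        simp only [Finset.sum_apply, Pi.zero_apply]
        apply sum_symm_zero
        intro i j
        rw [Finset.erase_right_comm, add_right_comm x]
      rw [h3, zero_add, sum_swap]
      apply sum_congr rfl
      intro i _
      apply sum_congr rfl
      intro j _
      rw [Finset.erase_right_comm]
    rw [h1, cone_sum]
    rfl

/-- indicator vector -/
def ind (u : Finset (Fin d)) : Fin d → ℤ := fun i => if i ∈ u then 1 else 0

lemma ind_insert {u : Finset (Fin d)} {i : Fin d} (h : i ∉ u) :
    ind (insert i u) = Pi.single i 1 + ind u := by
  funext j
  by_cases hj : j = i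
  · subst hj; simp [ind, h]
  · simp [ind, hj]

lemma ind_empty : ind (∅ : Finset (Fin d)) = 0 := by
  funext j; simp [ind]

lemma kuhn_supp (k : ℕ) : ∀ (S : Finset (Fin d)) (x : Fin d → ℤ) (σ : Finset C), S.card = k →
    kuhn χ k S x σ ≠ 0 → σ.card = k + 1 ∧ σ ⊆ S.powerset.image (fun u => χ (x + ind u)) := by
  induction k with
  | zero =>
    intro S x σ hS hne
    simp only [kuhn] at hne
    split_ifs at hne with h
    · subst h
      refine ⟨by simp, ?_⟩
      rw [singleton_subset_iff, mem_image]
      exact ⟨∅, by simp, by simp [ind_empty]⟩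
    · exact absurd rfl hne
  | succ k ih =>
    intro S x σ hS hne
    simp only [kuhn, cone] at hne
    split_ifs at hne with h
    · rw [Finset.sum_apply] at hne
      obtain ⟨i, hi, hne'⟩ := exists_ne_zero_of_sum_ne_zero hne
      obtain ⟨h1, h2⟩ := ih _ _ _ (by rw [card_erase_of_mem hi]; omega) hne'
      refine ⟨by rw [card_erase_of_mem h] at h1; omega, ?_⟩
      intro c hc
      rw [mem_image]
      by_cases hcx : c = χ x
      · exact ⟨∅, by simp, by simp [ind_empty, hcx]⟩
      · obtain ⟨u, hu, huc⟩ := mem_image.1 (h2 (mem_erase.2 ⟨hcx, hc⟩))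
        rw [mem_powerset] at hu
        have hiu : i ∉ u := fun hh => by simpa using hu hh
        refine ⟨insert i u, ?_, ?_⟩
        · rw [mem_powerset]
          exact insert_subset hi (hu.trans (erase_subset _ _))
        · rw [ind_insert hiu, ← add_assoc]
          exact huc
    · exact absurd rfl hne

/-- The cochain attached to a simplex of colors. -/
def co (σ : Finset C) : Cochain d := fun S x => kuhn χ S.card S x σ

lemma delta_co (ρ : Finset C) (hρ : ρ ≠ ∅) :
    delta (co χ ρ) = ∑ c ∈ ρᶜ, co χ (insert c ρ) := by
  funext S x
  simp only [Finset.sum_apply, delta, co]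
  rcases Nat.eq_zero_or_pos S.card with h | h
  · have h1 := bd_kuhn_zero χ S x ρ
    rw [if_neg hρ] at h1
    rw [h]
    rw [card_eq_zero] at h
    subst h
    simpa [bd] using h1.symm
  · obtain ⟨k, hk⟩ : ∃ k, S.card = k + 1 := ⟨S.card - 1, by omega⟩
    have h1 := congrFun (bd_kuhn χ k S x hk) ρ
    simp only [bd, Finset.sum_apply, Pi.add_apply] at h1
    rw [hk, h1]
    apply sum_congr rfl
    intro i hi
    have : (S.erase i).card = k := by rw [card_erase_of_mem hi]; omega
    rw [this]

/-- simplices of given cardinality containing a color -/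
def star (c : C) (k : ℕ) : Finset (Finset C) := univ.filter fun σ => c ∈ σ ∧ σ.card = k

lemma mem_star {c : C} {k : ℕ} {σ : Finset C} : σ ∈ star c k ↔ c ∈ σ ∧ σ.card = k := by
  simp [star]

lemma pair_sum (c₀ : C) (k : ℕ) (f : Finset C → ℕ) :
    ∑ σ ∈ star c₀ k, ∑ c ∈ σᶜ, f (insert c σ) ≤ (k + 1) * ∑ τ ∈ star c₀ (k + 1), f τ := by
  have h1 : (k + 1) * ∑ τ ∈ star c₀ (k + 1), f τ = ∑ τ ∈ star c₀ (k + 1), ∑ _c ∈ τ, f τ := by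
    rw [mul_sum]
    apply sum_congr rfl
    intro τ hτ
    rw [sum_const, (mem_star.1 hτ).2, smul_eq_mul]
  rw [h1, sum_sigma', sum_sigma']
  have hinj : Set.InjOn (fun p : (_ : Finset C) × C => (⟨insert p.2 p.1, p.2⟩ : (_ : Finset C) × C))
      ((star c₀ k).sigma fun σ => σᶜ : Finset ((_ : Finset C) × C)) := by
    rintro ⟨σ, c⟩ h ⟨σ', c'⟩ h' heq
    simp only [Sigma.mk.injEq, heq_eq_eq] at heq
    obtain ⟨h2, rfl⟩ := heq
    simp only [coe_sigma, Set.mem_sigma_iff, mem_coe, mem_compl] at h h'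
    have : σ = σ' := by rw [← erase_insert h.2, h2, erase_insert h'.2]
    rw [this]
  have h2 := sum_image (f := fun p : (_ : Finset C) × C => f p.1) hinj
  simp only at h2
  rw [← h2]
  apply sum_le_sum_of_subset
  rintro ⟨τ, c⟩ h
  simp only [mem_image, mem_sigma, mem_star, mem_compl, Sigma.exists, Sigma.mk.injEq,
    heq_eq_eq] at h
  obtain ⟨σ, c', ⟨⟨h3, h4⟩, h5⟩, h6, rfl⟩ := h
  subst h6
  simp [mem_star, h3, card_insert_of_notMem h5, h4]

/-- the color class in the closed box -/
def cls (n : ℕ) (c : C) : Finset (Fin d → ℤ) :=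
  (Fintype.piFinset fun _ => Icc (0 : ℤ) n).filter fun x => χ x = c

lemma co_count (n : ℕ) (c₀ : C) (k : ℕ) :
    ∑ σ ∈ star c₀ k, size n (co χ σ) ≤ 2 ^ d * 2 ^ d * 2 ^ 2 ^ d * (cls χ n c₀).card := by
  simp only [size]
  rw [← card_sigma]
  have hsub : ((star c₀ k).sigma fun σ => supp n (co χ σ)) ⊆
      ((univ : Finset (Finset (Fin d))) ×ˢ (univ : Finset (Finset (Fin d))) ×ˢ
        (univ : Finset (Finset (Finset (Fin d)))) ×ˢ cls χ n c₀).image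
      (fun r => ⟨r.2.2.1.image (fun u => χ (r.2.2.2 - ind r.2.1 + ind u)),
        (r.1, r.2.2.2 - ind r.2.1)⟩) := by
    rintro ⟨σ, S, x⟩ h
    simp only [mem_sigma, mem_star, mem_supp] at h
    obtain ⟨⟨h1, h2⟩, h3, h4⟩ := h
    have h5 := (kuhn_supp χ _ S x σ rfl h4).2
    obtain ⟨U, hU, hUσ⟩ := subset_image_iff.1 h5
    obtain ⟨u, hu, huc⟩ := mem_image.1 (h5 h1)
    rw [mem_image]
    refine ⟨(S, u, U, x + ind u), ?_, ?_⟩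
    · simp only [mem_product, mem_univ, true_and, cls, mem_filter, Fintype.mem_piFinset, mem_Icc]
      refine ⟨fun i => ?_, huc⟩
      have := mem_box.1 h3 i
      simp only [Pi.add_apply, ind]
      split_ifs <;> omega
    · simp only [add_sub_cancel_right, hUσ]
  refine (card_le_card hsub).trans (card_image_le.trans ?_)
  simp only [card_product, card_univ, Fintype.card_finset, Fintype.card_fin]
  apply le_of_eq
  ring

/-- the constants -/
def L (d m : ℕ) : ℕ → ℕ
  | 0 => 0
  | j + 1 => d * (2 ^ d * 2 ^ d * 2 ^ 2 ^ d + (m + 2) * L d m j)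

lemma size_step {n N m j k : ℕ} (hn : 1 ≤ n) (hkj : k + j = m)
    (hN : ∀ c, (cls χ n c).card ≤ N) (B : Finset C → Cochain d) (c₀ : C)
    (hB : ∑ τ ∈ star c₀ (k + 2), size n (B τ) ≤ L d m j * N * n ^ j) :
    ∑ σ ∈ star c₀ (k + 1), size n (co χ σ + ∑ c ∈ σᶜ, B (insert c σ)) ≤
      (2 ^ d * 2 ^ d * 2 ^ 2 ^ d + (m + 2) * L d m j) * N * n ^ j := by
  have hp : 1 ≤ n ^ j := Nat.one_le_pow _ _ hn
  calc ∑ σ ∈ star c₀ (k + 1), size n (co χ σ + ∑ c ∈ σᶜ, B (insert c σ))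
      ≤ ∑ σ ∈ star c₀ (k + 1), (size n (co χ σ) + ∑ c ∈ σᶜ, size n (B (insert c σ))) :=
        sum_le_sum fun σ _ => (size_add _ _ _).trans (Nat.add_le_add_left (size_sum _ _ _) _)
    _ = ∑ σ ∈ star c₀ (k + 1), size n (co χ σ) +
        ∑ σ ∈ star c₀ (k + 1), ∑ c ∈ σᶜ, size n (B (insert c σ)) := sum_add_distrib
    _ ≤ 2 ^ d * 2 ^ d * 2 ^ 2 ^ d * N + (m + 2) * (L d m j * N * n ^ j) := by
        apply add_le_add
        · exact (co_count χ n c₀ _).trans (Nat.mul_le_mul_left _ (hN c₀))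
        · refine (pair_sum c₀ (k + 1) fun τ => size n (B τ)).trans ?_
          exact Nat.mul_le_mul (by omega) hB
    _ ≤ 2 ^ d * 2 ^ d * 2 ^ 2 ^ d * N * n ^ j + (m + 2) * (L d m j * N * n ^ j) :=
        Nat.add_le_add_right (Nat.le_mul_of_pos_right _ hp) _
    _ = _ := by ring

lemma co_dim {σ : Finset C} {S : Finset (Fin d)} {x : Fin d → ℤ} (h : co χ σ S x ≠ 0) :
    σ.card = S.card + 1 := (kuhn_supp χ _ S x σ rfl h).1

lemma main_step {n N m : ℕ} (hn : 1 ≤ n)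
    (hχ : ∀ (S : Finset (Fin d)) (x : Fin d → ℤ), S.card = m + 1 →
      (S.powerset.image fun u => χ (x + ind u)).card ≤ m + 1)
    (hN : ∀ c, (cls χ n c).card ≤ N) (j : ℕ) : ∀ k, k + j = m →
    ∃ B : Finset C → Cochain d,
      (∀ σ : Finset C, σ.card = k + 1 → delta (co χ σ + ∑ c ∈ σᶜ, B (insert c σ)) = 0) ∧
      (∀ τ : Finset C, τ.card = k + 2 → ∀ S x, B τ S x ≠ 0 → S.card = k) ∧
      ∀ c₀, ∑ τ ∈ star c₀ (k + 2), size n (B τ) ≤ L d m j * N * n ^ j := by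
  induction j with
  | zero =>
    intro k hk
    refine ⟨0, ?_, by simp, by simp [size_zero]⟩
    intro σ hσ
    simp only [Pi.zero_apply, sum_const_zero, add_zero]
    rw [delta_co χ σ (by rintro rfl; simp at hσ)]
    apply sum_eq_zero
    intro c hc
    rw [mem_compl] at hc
    funext S x
    by_contra hne
    have h1 := kuhn_supp χ _ S x _ rfl hne
    rw [card_insert_of_notMem hc] at h1
    have h2 := card_le_card h1.2
    rw [card_insert_of_notMem hc] at h2
    have h3 := hχ S x (by omega)
    omega
  | succ j ih =>
    intro k hk
    obtain ⟨B, hB1, hB2, hB3⟩ := ih (k + 1) (by omega)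
    have hfill : ∀ σ : Finset C, ∃ b : Cochain d, σ.card = k + 2 →
        (delta b = co χ σ + ∑ c ∈ σᶜ, B (insert c σ)) ∧ (∀ S x, b S x ≠ 0 → S.card = k) ∧
        size n b ≤ d * (n * size n (co χ σ + ∑ c ∈ σᶜ, B (insert c σ))) := by
      intro σ
      by_cases hσ : σ.card = k + 2
      · obtain ⟨b, hb⟩ := fill hn k (co χ σ + ∑ c ∈ σᶜ, B (insert c σ)) (by
          intro S x hne
          by_cases h0 : co χ σ S x = 0
          · rw [Pi.add_apply, Pi.add_apply, h0, zero_add, Finset.sum_apply, Finset.sum_apply] at hne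
            obtain ⟨c, hc, hne'⟩ := exists_ne_zero_of_sum_ne_zero hne
            rw [mem_compl] at hc
            exact hB2 _ (by rw [card_insert_of_notMem hc]; omega) _ _ hne'
          · have := co_dim χ h0
            omega) (hB1 σ (by omega))
        exact ⟨b, fun _ => hb⟩
      · exact ⟨0, fun h => absurd h hσ⟩
    choose B' hB' using hfill
    refine ⟨B', ?_, fun τ hτ => (hB' τ hτ).2.1, ?_⟩
    · intro ρ hρ
      rw [delta_add, delta_co χ ρ (by rintro rfl; simp at hρ), delta_sum]
      have h1 : ∑ c ∈ ρᶜ, delta (B' (insert c ρ)) = ∑ c ∈ ρᶜ, co χ (insert c ρ) +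
          ∑ c ∈ ρᶜ, ∑ c' ∈ ρᶜ.erase c, B (insert c' (insert c ρ)) := by
        rw [← sum_add_distrib]
        apply sum_congr rfl
        intro c hc
        rw [mem_compl] at hc
        rw [(hB' _ (by rw [card_insert_of_notMem hc]; omega)).1, compl_insert]
      have h2 : ∑ c ∈ ρᶜ, ∑ c' ∈ ρᶜ.erase c, B (insert c' (insert c ρ)) = 0 := by
        funext S x
        simp only [Finset.sum_apply, Pi.zero_apply]
        apply sum_symm_zero
        intro i l
        rw [insert_comm]
      rw [h1, h2, add_zero, cochain_add_self]
    · intro c₀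
      calc ∑ τ ∈ star c₀ (k + 2), size n (B' τ)
          ≤ ∑ τ ∈ star c₀ (k + 2),
              d * (n * size n (co χ τ + ∑ c ∈ τᶜ, B (insert c τ))) :=
            sum_le_sum fun τ hτ => (hB' τ (mem_star.1 hτ).2).2.2
        _ = d * (n * ∑ τ ∈ star c₀ (k + 2),
              size n (co χ τ + ∑ c ∈ τᶜ, B (insert c τ))) := by
            rw [mul_sum, mul_sum]
        _ ≤ d * (n * ((2 ^ d * 2 ^ d * 2 ^ 2 ^ d + (m + 2) * L d m j) * N * n ^ j)) :=
            Nat.mul_le_mul_left _ (Nat.mul_le_mul_left _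
              (size_step χ hn (k := k + 1) (by omega) hN B c₀ (hB3 c₀)))
        _ = _ := by rw [L]; ring

lemma const_of_cocycle (a : Cochain d) (ha : delta a = 0) (x y : Fin d → ℤ) :
    a ∅ x = a ∅ y := by
  have step : ∀ (i : Fin d) (z : Fin d → ℤ), a ∅ (z + Pi.single i 1) = a ∅ z := by
    intro i z
    have h := congrFun (congrFun ha {i}) z
    simp only [delta, sum_singleton, erase_singleton, Pi.zero_apply] at h
    have := CharTwo.add_self_eq_zero (a ∅ z)
    linear_combination h - this
  have upd : ∀ (i : Fin d) (z : Fin d → ℤ) (p t : ℤ),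
      a ∅ (Function.update z i t) = a ∅ (Function.update z i p) := by
    intro i z p t
    induction t using Int.inductionOn' (b := p) with
    | zero => rfl
    | succ k hk ih => rw [← ih, ← upd_succ, step]
    | pred k hk ih => rw [← ih, ← step i (Function.update z i (k - 1)), upd_succ, sub_add_cancel]
  have hT : ∀ T : Finset (Fin d), a ∅ (fun i => if i ∈ T then y i else x i) = a ∅ x := by
    intro T
    induction T using Finset.induction_on with
    | empty => simp
    | insert i T hi ih =>
      rw [← ih]
      have h1 : (fun l => if l ∈ insert i T then y l else x l) =
          Function.update (fun l => if l ∈ T then y l else x l) i (y i) := by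
        funext l
        by_cases h : l = i
        · subst h; simp
        · simp [h]
      rw [h1, upd i _ (x i)]
      congr 1
      funext l
      by_cases h : l = i
      · subst h; simp [hi]
      · simp [h]
  have := hT univ
  simpa using this.symm

theorem core {n N m : ℕ} (hn : 1 ≤ n)
    (hχ : ∀ (S : Finset (Fin d)) (x : Fin d → ℤ), S.card = m + 1 →
      (S.powerset.image fun u => χ (x + ind u)).card ≤ m + 1)
    (hN : ∀ c, (cls χ n c).card ≤ N) :
    n ^ d ≤ (2 ^ d * 2 ^ d * 2 ^ 2 ^ d + (m + 2) * L d m m) * N * n ^ m := by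
  by_contra hcon
  obtain ⟨B, hB1, hB2, hB3⟩ := main_step χ hn hχ hN m 0 (by omega)
  have hz : ∀ c, (co χ {c} + ∑ c' ∈ ({c} : Finset C)ᶜ, B (insert c' {c})) ∅ 0 = 0 := by
    intro c
    by_contra hne
    apply hcon
    have h1 := size_step χ hn (k := 0) (by omega) hN B c (hB3 c)
    refine le_trans ?_ h1
    have h2 : ({c} : Finset C) ∈ star c (0 + 1) := by simp [mem_star]
    refine le_trans ?_ (single_le_sum
      (f := fun σ => size n (co χ σ + ∑ c ∈ σᶜ, B (insert c σ))) (fun _ _ => Nat.zero_le _) h2)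
    have h3 : (box d n).card = n ^ d := by simp [box]
    rw [← h3]
    apply card_le_card_of_injOn (fun x => (∅, x))
    · intro x hx
      rw [mem_coe, mem_supp]
      refine ⟨hx, ?_⟩
      simp only
      rw [const_of_cocycle _ (hB1 {c} (by simp)) x 0]
      exact hne
    · intro x _ y _ h
      simpa using h
  have hsum : ∑ c : C, (co χ {c} + ∑ c' ∈ ({c} : Finset C)ᶜ, B (insert c' {c})) ∅ 0 = 0 :=
    sum_eq_zero fun c _ => hz c
  simp only [Pi.add_apply, Finset.sum_apply, sum_add_distrib] at hsum
  have h1 : ∑ c : C, co χ {c} ∅ 0 = 1 := by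
    simp [co, kuhn]
  have h2 : ∑ c : C, ∑ c' ∈ ({c} : Finset C)ᶜ, B (insert c' {c}) ∅ 0 = 0 := by
    have := sum_symm_zero (univ : Finset C) (fun c c' => B {c', c} ∅ 0) (by
      intro i j
      rw [pair_comm])
    rw [← this]
    apply sum_congr rfl
    intro c _
    apply sum_congr
    · ext; simp
    · intros; rfl
  rw [h1, h2] at hsum
  simp at hsum

end colors

/-- clamping into the box -/
def clamp {d : ℕ} (n : ℕ) (x : Fin d → ℤ) : Fin d → ℤ := fun i => max 0 (min (x i) n)

end

end CubeCol


/-- **Size of components of a cube coloring** (Matdinov, Theorem 1, counting form).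
For all integers `d ≥ 1` and `0 ≤ m ≤ d−1` there is a constant `f(d,m) > 0` such that:
for every `n ≥ 1` and every coloring `χ` of the lattice points of the cube `{0,…,n}^d`
(encoded as integer points `x : Fin d → ℤ` with `0 ≤ x i ≤ n`) such that every cubical
`(m+1)`-dimensional face of the grid carries at most `m+1` distinct colors on its `2^(m+1)`
vertices, some color `c` is used on at least `f(d,m) · n^(d−m)` grid points. -/
theorem cube_coloring_large_color_class
    (d m : ℕ) (hd : 1 ≤ d) (hm : m ≤ d - 1) :
    ∃ f : ℝ, 0 < f ∧
      ∀ (n : ℕ), 1 ≤ n → ∀ (Colors : Type) (χ : (Fin d → ℤ) → Colors),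
        -- every cubical (m+1)-face of the grid, given by a direction set `S` with
        -- `|S| = m+1` and a base point `x` in the grid with `x i ≤ n−1` for `i ∈ S`,
        -- carries at most `m+1` distinct colors on its vertices
        (∀ (S : Finset (Fin d)) (x : Fin d → ℤ),
            S.card = m + 1 →
            (∀ i, 0 ≤ x i ∧ x i ≤ n) →
            (∀ i ∈ S, x i ≤ (n : ℤ) - 1) →
            {c : Colors | ∃ ε : Fin d → Bool,
                χ (fun i => x i + if i ∈ S ∧ ε i then 1 else 0) = c}.ncard ≤ m + 1) →
        ∃ c : Colors,
          f * (n : ℝ) ^ (d - m) ≤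
            ({x : Fin d → ℤ | (∀ i, 0 ≤ x i ∧ x i ≤ n) ∧ χ x = c}.ncard : ℝ) := by
  classical
  have hmd : m ≤ d := by omega
  set K : ℕ := 2 ^ d * 2 ^ d * 2 ^ 2 ^ d + (m + 2) * CubeCol.L d m m with hK
  have hKpos : 0 < K := by positivity
  refine ⟨1 / (K : ℝ), by positivity, ?_⟩
  intro n hn Colors χ hχ
  have hcl : ∀ x : Fin d → ℤ, ∀ i, 0 ≤ CubeCol.clamp n x i ∧ CubeCol.clamp n x i ≤ n := by
    intro x i
    simp only [CubeCol.clamp]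
    omega
  have hclid : ∀ x : Fin d → ℤ, (∀ i, 0 ≤ x i ∧ x i ≤ n) → CubeCol.clamp n x = x := by
    intro x hx
    funext i
    have := hx i
    simp only [CubeCol.clamp]
    omega
  have hfin : (Set.range fun x => χ (CubeCol.clamp n x)).Finite := by
    have h1 : (Set.univ.pi fun _ : Fin d => Set.Icc (0 : ℤ) n).Finite :=
      Set.Finite.pi fun _ => Set.finite_Icc _ _
    refine (h1.image χ).subset ?_
    rintro _ ⟨x, rfl⟩
    exact ⟨CubeCol.clamp n x, fun i _ => hcl x i, rfl⟩
  let C := Set.range fun x => χ (CubeCol.clamp n x)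
  have : Fintype C := hfin.fintype
  have : Nonempty C := ⟨⟨_, 0, rfl⟩⟩
  let χ' : (Fin d → ℤ) → C := fun x => ⟨χ (CubeCol.clamp n x), x, rfl⟩
  have hχ' : ∀ (S : Finset (Fin d)) (x : Fin d → ℤ), S.card = m + 1 →
      (S.powerset.image fun u => χ' (x + CubeCol.ind u)).card ≤ m + 1 := by
    intro S x hS
    let y : Fin d → ℤ := fun i =>
      if i ∈ S then max 0 (min (x i) ((n : ℤ) - 1)) else CubeCol.clamp n x i
    have hy := hχ S y hS
      (by
        intro i
        simp only [y, CubeCol.clamp]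
        split_ifs <;> omega)
      (by
        intro i hi
        simp only [y, hi, if_true]
        omega)
    refine le_trans ?_ hy
    rw [← Finset.card_image_of_injective _ (Subtype.val_injective (p := fun c => c ∈ C)),
      ← Set.ncard_coe_finset]
    apply Set.ncard_le_ncard
    · intro c hc
      simp only [Finset.coe_image, Set.mem_image, Finset.mem_coe, Finset.mem_powerset,
        exists_exists_and_eq_and] at hc
      obtain ⟨u, hu, rfl⟩ := hc
      refine ⟨fun i => decide (CubeCol.clamp n (x + CubeCol.ind u) i = y i + 1), ?_⟩
      simp only [χ']
      congr 1
      funext i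
      by_cases hi : i ∈ S
      · simp only [hi, true_and, decide_eq_true_eq]
        simp only [y, hi, if_true, CubeCol.clamp, Pi.add_apply, CubeCol.ind]
        split_ifs <;> omega
      · have hiu : i ∉ u := fun h => hi (hu h)
        simp [y, hi, CubeCol.clamp, CubeCol.ind, hiu]
    · exact Set.finite_range _
  obtain ⟨c, hc⟩ := Finite.exists_max fun c : C => (CubeCol.cls χ' n c).card
  have hmain := CubeCol.core χ' hn hχ' hc
  refine ⟨c.1, ?_⟩
  have hcls : {x : Fin d → ℤ | (∀ i, 0 ≤ x i ∧ x i ≤ n) ∧ χ x = c.1}.ncard =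
      (CubeCol.cls χ' n c).card := by
    rw [← Set.ncard_coe_finset]
    congr 1
    ext x
    simp only [Set.mem_ofPred_eq, CubeCol.cls, Finset.coe_filter, Fintype.mem_piFinset,
      Finset.mem_Icc]
    apply and_congr_right
    intro hx
    simp only [χ', Subtype.ext_iff, hclid x hx]
  rw [hcls]
  have h2 : n ^ (d - m) ≤ K * (CubeCol.cls χ' n c).card := by
    have h3 : n ^ (d - m) * n ^ m ≤ K * (CubeCol.cls χ' n c).card * n ^ m := by
      rw [← pow_add, Nat.sub_add_cancel hmd]
      exact hmain
    exact Nat.le_of_mul_le_mul_right h3 (by positivity)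
  have h3 : (n : ℝ) ^ (d - m) ≤ K * ((CubeCol.cls χ' n c).card : ℝ) := by exact_mod_cast h2
  have hKr : (0 : ℝ) < K := by exact_mod_cast hKpos
  rw [one_div, inv_mul_le_iff₀ hKr]
  exact h3
end

section
/- Let d ≥ 1 and m ≥ 0 be integers and let (C_i)_{i∈I} be a finite family of closed subsets of the cube [0,1]^d whose union is the whole cube and such that every point of the cube belongs to at most m+1 of the sets C_i. Then there exist an index i ∈ I and a set J of coordinate directions with |J| ≥ d−m such that for every j ∈ J the set C_i intersects both opposite facets {x ∈ [0,1]^d : x_j = 0} and {x ∈ [0,1]^d : x_j = 1}. -/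
open MeasureTheory Set

theorem det_lagrange (d : ℕ) (t : Fin (d+1) → ℝ) (ht : Function.Injective t) :
    ∃ c : Fin (d+1) → ℝ, ∑ k, c k = 1 ∧ ∀ A : (Fin d → ℝ) →L[ℝ] (Fin d → ℝ),
      (1 + A).det = ∑ k, c k * (1 + t k • A).det := by
  refine ⟨fun k => (Lagrange.basis Finset.univ t k).eval 1, ?_, ?_⟩
  · rw [← Polynomial.eval_finsetSum, Lagrange.sum_basis ht.injOn Finset.univ_nonempty]
    simp
  · intro A
    set M : Matrix (Fin d) (Fin d) ℝ := LinearMap.toMatrix' (A : (Fin d → ℝ) →ₗ[ℝ] (Fin d → ℝ))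
    let p : Polynomial ℝ := Matrix.det
      ((Polynomial.X : Polynomial ℝ) • M.map Polynomial.C + (1 : Matrix (Fin d) (Fin d) ℝ).map Polynomial.C)
    have hp : ∀ s : ℝ, p.eval s = (1 + s • A).det := by
      intro s
      have h1 : (1 + s • A).det = Matrix.det (1 + s • M) := by
        rw [ContinuousLinearMap.det, ← LinearMap.det_toMatrix']
        congr 1
        simp [M, LinearMap.toMatrix'_one]
      rw [h1, ← Polynomial.coe_evalRingHom, RingHom.map_det]
      congr 1
      ext i j
      simp [Matrix.one_apply, add_comm]
      split_ifs <;> simp [mul_comm]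
    have hdeg : p.degree < (Finset.univ : Finset (Fin (d+1))).card := by
      have := Polynomial.natDegree_det_X_add_C_le M 1
      refine lt_of_le_of_lt Polynomial.degree_le_natDegree ?_
      have h2 : p.natDegree < d + 1 := by
        have : p.natDegree ≤ Fintype.card (Fin d) := this
        simp at this; omega
      simpa using (by exact_mod_cast h2 : (p.natDegree : WithBot ℕ) < ((d+1 : ℕ) : WithBot ℕ))
    have := Lagrange.eq_interpolate (f := p) ht.injOn hdeg
    have h3 := congrArg (Polynomial.eval 1) this
    rw [hp 1, one_smul, Lagrange.interpolate_apply, Polynomial.eval_finsetSum] at h3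
    rw [h3]
    refine Finset.sum_congr rfl fun k _ => ?_
    simp [hp, mul_comm]

theorem det_pos_small {d : ℕ} (A : (Fin d → ℝ) →L[ℝ] (Fin d → ℝ)) (hA : ‖A‖ < 1) :
    0 < (1 + A).det := by
  have hne : ∀ s ∈ Icc (0:ℝ) 1, (1 + s • A).det ≠ 0 := by
    intro s hs
    have hn : ‖-(s • A)‖ < 1 := by
      rw [norm_neg, norm_smul, Real.norm_of_nonneg hs.1]
      nlinarith [hs.2, norm_nonneg A]
    have hu : IsUnit (1 - (-(s • A))) := isUnit_one_sub_of_norm_lt_one hn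
    rw [sub_neg_eq_add] at hu
    have h2 : IsUnit ((1 + s • A : (Fin d → ℝ) →L[ℝ] (Fin d → ℝ)) : (Fin d → ℝ) →ₗ[ℝ] (Fin d → ℝ)) :=
      hu.map (ContinuousLinearMap.toLinearMapRingHom : ((Fin d → ℝ) →L[ℝ] (Fin d → ℝ)) →+* _)
    exact (LinearMap.isUnit_iff_isUnit_det _).1 h2 |>.ne_zero
  have hc : ContinuousOn (fun s : ℝ => (1 + s • A).det) (Icc 0 1) := by
    have : Continuous (fun s : ℝ => (1 + s • A).det) :=
      ContinuousLinearMap.continuous_det.comp (by fun_prop)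
    exact this.continuousOn
  by_contra h
  push Not at h
  have h0 : (1 + (0:ℝ) • A).det = 1 := by simp [ContinuousLinearMap.det]
  have := intermediate_value_Icc' (zero_le_one) hc
  obtain ⟨s, hs, hs'⟩ := this (show (0:ℝ) ∈ Icc _ _ from ⟨by simpa using h, by simp only [h0]; exact zero_le_one⟩)
  exact hne s hs hs'

theorem integral_det {d : ℕ} (u : (Fin d → ℝ) → (Fin d → ℝ)) (hu : Differentiable ℝ u)
    (K : NNReal) (hK : ∀ x ∈ Icc (0 : Fin d → ℝ) 1, ‖fderiv ℝ u x‖₊ ≤ K)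
    (h01 : ∀ x ∈ Icc (0 : Fin d → ℝ) 1, ∀ j, x j + u x j ∈ Icc (0:ℝ) 1)
    (h0 : ∀ x ∈ Icc (0 : Fin d → ℝ) 1, ∀ j, x j = 0 → u x j = 0)
    (h1 : ∀ x ∈ Icc (0 : Fin d → ℝ) 1, ∀ j, x j = 1 → u x j = 0)
    (t : NNReal) (ht1 : t ≤ 1) (ht : t * K < 1) :
    ∫ x in Icc (0 : Fin d → ℝ) 1, (1 + (t:ℝ) • fderiv ℝ u x).det = 1 := by
  set Q := Icc (0 : Fin d → ℝ) 1 with hQ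
  have hlip : LipschitzOnWith K u Q :=
    (convex_Icc _ _).lipschitzOnWith_of_nnnorm_fderiv_le (fun x _ => hu x) hK
  let G : (Fin d → ℝ) → (Fin d → ℝ) := fun x => x + (t:ℝ) • u x
  have hG : ∀ x ∈ Q, HasFDerivWithinAt G (1 + (t:ℝ) • fderiv ℝ u x) Q x := by
    intro x _
    exact ((hasFDerivAt_id x).add ((hu x).hasFDerivAt.const_smul (t:ℝ))).hasFDerivWithinAt
  have ht' : (t:ℝ) * K < 1 := by exact_mod_cast ht
  have hinj : InjOn G Q := by
    intro x hx y hy hxy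
    have h2 := hlip.dist_le_mul x hx y hy
    have h3 : x - y = (t:ℝ) • (u y - u x) := by
      have : x + (t:ℝ) • u x = y + (t:ℝ) • u y := hxy
      rw [smul_sub, sub_eq_sub_iff_add_eq_add, this, add_comm]
    have h4 : ‖x - y‖ = t * ‖u x - u y‖ := by
      rw [h3, norm_smul, norm_sub_rev, Real.norm_of_nonneg t.coe_nonneg]
    rw [dist_eq_norm, dist_eq_norm] at h2
    have h5 : ‖x - y‖ ≤ t * K * ‖x - y‖ := by
      calc ‖x - y‖ = t * ‖u x - u y‖ := h4
        _ ≤ t * (K * ‖x - y‖) := by gcongr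
        _ = _ := by ring
    have h6 : ‖x - y‖ = 0 := by nlinarith [norm_nonneg (x - y)]
    exact sub_eq_zero.1 (norm_eq_zero.1 h6)
  let π : (Fin d → ℝ) → (Fin d → ℝ) := fun x j => max 0 (min 1 (x j))
  have hπQ : ∀ x, π x ∈ Q := fun x => ⟨fun j => le_max_left _ _, fun j => max_le zero_le_one (min_le_left _ _)⟩
  have hπl : LipschitzWith 1 π := by
    refine LipschitzWith.of_dist_le_mul fun x y => ?_
    rw [NNReal.coe_one, one_mul]
    refine (dist_pi_le_iff dist_nonneg).2 fun j => ?_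
    refine le_trans ?_ (dist_le_pi_dist x y j)
    simp only [π, Real.dist_eq]
    calc |max 0 (min 1 (x j)) - max 0 (min 1 (y j))| ≤ |min 1 (x j) - min 1 (y j)| := by
            simpa using abs_max_sub_max_le_max 0 (min 1 (x j)) 0 (min 1 (y j))
      _ ≤ |x j - y j| := by simpa using abs_min_sub_min_le_max 1 (x j) 1 (y j)
  have himg : G '' Q = Q := by
    apply Subset.antisymm
    · rintro _ ⟨x, hx, rfl⟩
      have ht1' : (t:ℝ) ≤ 1 := by exact_mod_cast ht1
      have ht0 : (0:ℝ) ≤ t := t.2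
      constructor
      · intro j
        have := (h01 x hx j).1
        have := hx.1 j
        simp only [G, Pi.zero_apply, Pi.add_apply, Pi.smul_apply, smul_eq_mul] at *
        nlinarith
      · intro j
        have := (h01 x hx j).2
        have := hx.2 j
        simp only [G, Pi.one_apply, Pi.add_apply, Pi.smul_apply, smul_eq_mul] at *
        nlinarith
    · intro y hy
      let Φ : (Fin d → ℝ) → (Fin d → ℝ) := fun x => π (y - (t:ℝ) • u (π x))
      have hΦ : ContractingWith (t * K) Φ := by
        refine ⟨ht, LipschitzWith.of_dist_le_mul fun x z => ?_⟩
        have e1 := hπl.dist_le_mul (y - (t:ℝ) • u (π x)) (y - (t:ℝ) • u (π z))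
        have e2 := hπl.dist_le_mul x z
        have e3 := hlip.dist_le_mul (π x) (hπQ x) (π z) (hπQ z)
        rw [NNReal.coe_one, one_mul] at e1 e2
        rw [dist_sub_left, dist_smul₀, Real.norm_of_nonneg t.coe_nonneg] at e1
        calc dist (Φ x) (Φ z) ≤ t * dist (u (π x)) (u (π z)) := e1
          _ ≤ t * (K * dist x z) := by gcongr; exact e3.trans (by gcongr)
          _ = _ := by push_cast; ring
      obtain ⟨x, hx⟩ : ∃ x, Φ x = x := ⟨_, hΦ.fixedPoint_isFixedPt⟩
      have hxQ : x ∈ Q := hx ▸ hπQ _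
      have hπx : π x = x := by
        ext j
        have a := hxQ.1 j
        have b := hxQ.2 j
        simp only [Pi.zero_apply, Pi.one_apply] at a b
        simp only [π]
        rw [min_eq_right b, max_eq_right a]
      refine ⟨x, hxQ, ?_⟩
      ext j
      have hj : max 0 (min 1 (y j - t * u x j)) = x j := by
        have := congrFun hx j
        simpa [Φ, π, hπx] using this
      have a := hy.1 j
      have b := hy.2 j
      simp only [Pi.zero_apply, Pi.one_apply] at a b
      simp only [G, Pi.add_apply, Pi.smul_apply, smul_eq_mul]
      rcases le_total (y j - t * u x j) 0 with c | c
      · rw [max_eq_left ((min_le_right _ _).trans c)] at hj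
        have := h0 x hxQ j hj.symm
        rw [this] at c ⊢
        linarith
      · rcases le_total 1 (y j - t * u x j) with e | e
        · rw [min_eq_left e, max_eq_right zero_le_one] at hj
          have := h1 x hxQ j hj.symm
          rw [this] at e ⊢
          linarith
        · rw [min_eq_right e, max_eq_right c] at hj
          linarith
  have hcv := integral_image_eq_integral_abs_det_fderiv_smul volume measurableSet_Icc hG hinj (fun _ => (1:ℝ))
  rw [himg] at hcv
  have hvol : ∫ x in Q, (1:ℝ) = 1 := by
    simp [hQ, Measure.real, Real.volume_Icc_pi]
  rw [hvol] at hcv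
  rw [hcv]
  refine setIntegral_congr_fun measurableSet_Icc fun x hx => ?_
  have : 0 < (1 + (t:ℝ) • fderiv ℝ u x).det := by
    apply det_pos_small
    rw [norm_smul, Real.norm_of_nonneg t.coe_nonneg]
    refine lt_of_le_of_lt ?_ ht'
    gcongr
    exact_mod_cast hK x hx
  simp [abs_of_pos this]

theorem exists_not_zero_one {d : ℕ} (F : (Fin d → ℝ) → (Fin d → ℝ)) (hF : ContDiff ℝ 1 F)
    (h01 : ∀ x j, F x j ∈ Icc (0:ℝ) 1)
    (h0 : ∀ x ∈ Icc (0 : Fin d → ℝ) 1, ∀ j, x j = 0 → F x j = 0)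
    (h1 : ∀ x ∈ Icc (0 : Fin d → ℝ) 1, ∀ j, x j = 1 → F x j = 1) :
    ∃ x ∈ Icc (0 : Fin d → ℝ) 1, ∀ j, F x j ≠ 0 ∧ F x j ≠ 1 := by
  by_contra hcon
  push Not at hcon
  let u : (Fin d → ℝ) → (Fin d → ℝ) := fun x => F x - x
  have hu : ContDiff ℝ 1 u := hF.sub contDiff_id
  have hud : Differentiable ℝ u := hu.differentiable one_ne_zero
  have huc : Continuous (fderiv ℝ u) := hu.continuous_fderiv one_ne_zero
  obtain ⟨B, hB⟩ := (isCompact_Icc (a := (0 : Fin d → ℝ)) (b := 1)).exists_bound_of_continuousOn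
    huc.continuousOn
  let K : NNReal := B.toNNReal
  have hK : ∀ x ∈ Icc (0 : Fin d → ℝ) 1, ‖fderiv ℝ u x‖₊ ≤ K := by
    intro x hx
    exact NNReal.le_toNNReal_of_coe_le (hB x hx)
  let t : Fin (d+1) → NNReal := fun k => ((K + 1) * (k + 1))⁻¹
  have htinj : Function.Injective (fun k => (t k : ℝ)) := by
    intro a b hab
    have : t a = t b := NNReal.coe_injective hab
    have h2 := inv_injective this
    have h3 := mul_left_cancel₀ (by positivity) h2
    have h4 : ((a:ℕ) : NNReal) = (b : ℕ) := add_right_cancel h3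
    exact Fin.ext (by exact_mod_cast h4)
  obtain ⟨c, hc1, hc⟩ := det_lagrange d (fun k => (t k : ℝ)) htinj
  have hden : ∀ k : Fin (d+1), K + 1 ≤ (K+1) * ((k:ℕ) + 1 : NNReal) := fun k =>
    le_mul_of_one_le_right (by positivity) (by simp)
  have hint : ∀ k, ∫ x in Icc (0 : Fin d → ℝ) 1, (1 + (t k:ℝ) • fderiv ℝ u x).det = 1 := by
    intro k
    refine integral_det u hud K hK ?_ ?_ ?_ (t k) ?_ ?_
    · intro x _ j; simpa [u] using h01 x j
    · intro x hx j hj; simp [u, h0 x hx j hj, hj]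
    · intro x hx j hj; simp [u, h1 x hx j hj, hj]
    · exact inv_le_one_of_one_le₀ (le_trans (by simp) (hden k))
    · have : t k * K = K / ((K+1) * ((k:ℕ) + 1 : NNReal)) := by
        simp only [t]; rw [div_eq_mul_inv, mul_comm]
      rw [this, div_lt_one (by positivity)]
      exact lt_of_lt_of_le (by simp) (hden k)
  have hzero : ∀ x ∈ Icc (0 : Fin d → ℝ) 1, (1 + fderiv ℝ u x).det = 0 := by
    intro x hx
    have hFd : DifferentiableAt ℝ F x := hF.differentiable one_ne_zero x
    have e : 1 + fderiv ℝ u x = fderiv ℝ F x := by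
      have : fderiv ℝ u x = fderiv ℝ F x - 1 := (hFd.hasFDerivAt.sub (hasFDerivAt_id x)).fderiv
      rw [this]; abel
    obtain ⟨j, hj⟩ : ∃ j, F x j = 0 ∨ F x j = 1 := by
      obtain ⟨j, hj⟩ := hcon x hx
      exact ⟨j, or_iff_not_imp_left.2 hj⟩
    have hd : fderiv ℝ (fun y => F y j) x = 0 := by
      rcases hj with hj | hj
      · exact IsLocalMin.fderiv_eq_zero (Filter.Eventually.of_forall fun y => by
          simp only [hj]; exact (h01 y j).1)
      · exact IsLocalMax.fderiv_eq_zero (Filter.Eventually.of_forall fun y => by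
          simp only [hj]; exact (h01 y j).2)
    have hrow : ∀ v, fderiv ℝ F x v j = 0 := by
      intro v
      have h5 : fderiv ℝ (fun y => F y j) x v = fderiv ℝ F x v j :=
        congrArg (fun L => L v) ((hasFDerivAt_pi'.1 hFd.hasFDerivAt j).fderiv)
      rw [← h5, hd]; rfl
    rw [e, ContinuousLinearMap.det, ← LinearMap.det_toMatrix']
    apply Matrix.det_eq_zero_of_row_eq_zero j
    intro k
    simp [LinearMap.toMatrix'_apply, hrow]
  have : (0:ℝ) = 1 := by
    calc (0:ℝ) = ∫ x in Icc (0 : Fin d → ℝ) 1, (1 + fderiv ℝ u x).det := by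
          rw [setIntegral_congr_fun measurableSet_Icc (g := fun _ => (0:ℝ)) (fun x hx => hzero x hx)]
          simp
      _ = ∫ x in Icc (0 : Fin d → ℝ) 1, ∑ k, c k * (1 + (t k:ℝ) • fderiv ℝ u x).det := by
          exact integral_congr_ae (Filter.Eventually.of_forall fun x => hc _)
      _ = ∑ k, ∫ x in Icc (0 : Fin d → ℝ) 1, c k * (1 + (t k:ℝ) • fderiv ℝ u x).det := by
          refine integral_finsetSum _ fun k _ => ?_
          apply Continuous.integrableOn_Icc
          exact continuous_const.mul (ContinuousLinearMap.continuous_det.comp (by fun_prop))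
      _ = ∑ k, c k := by
          refine Finset.sum_congr rfl fun k _ => ?_
          rw [integral_const_mul, hint k, mul_one]
      _ = 1 := hc1
  exact zero_ne_one this

theorem exists_thick {X κ : Type*} [PseudoMetricSpace X] [Finite κ] (Q : Set X) (hQ : IsCompact Q)
    (D : κ → Set X) (hD : ∀ k, IsClosed (D k)) :
    ∃ δ > 0, ∀ y ∈ Q, ∃ x, ∀ k, y ∈ Metric.thickening δ (D k) → x ∈ D k := by
  let c : X → Set X := fun x => ⋂ k, ⋂ (_ : x ∉ D k), (D k)ᶜ
  have hc : ∀ x, IsOpen (c x) := fun x =>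
    isOpen_iInter_of_finite fun k => isOpen_iInter_of_finite fun _ => (hD k).isOpen_compl
  obtain ⟨δ, hδ, h⟩ := lebesgue_number_lemma_of_metric hQ hc (fun x _ => mem_iUnion.2 ⟨x, by
    simp only [c, mem_iInter]; exact fun k hk => hk⟩)
  refine ⟨δ, hδ, fun y hy => ?_⟩
  obtain ⟨x, hx⟩ := h y hy
  refine ⟨x, fun k hk => ?_⟩
  by_contra hxk
  obtain ⟨z, hz, hyz⟩ := Metric.mem_thickening_iff.1 hk
  have := hx (Metric.mem_ball'.2 hyz)
  simp only [c, mem_iInter] at this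
  exact this k hxk hz

theorem exists_vector {d m : ℕ} {κ : Type*} [Finite κ] (P : κ → Submodule ℝ (Fin d → ℝ))
    (hP : ∀ k, Module.finrank ℝ (P k) ≤ m) (T : Finset (Fin d)) (hT : m + 1 ≤ T.card)
    (s : Fin d → ℝ) (hs : ∀ j, s j ≠ 0) :
    ∃ w : Fin d → ℝ, (∀ j ∉ T, w j = 0) ∧ (∀ j ∈ T, 0 < s j * w j) ∧ ∀ k, w ∉ P k := by
  let φ : (Fin d → ℝ) →ₗ[ℝ] (Fin d → ℝ) :=
    LinearMap.pi fun j => (if j ∈ T then s j else 0) • LinearMap.proj j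
  have hφ : ∀ y j, φ y j = if j ∈ T then s j * y j else 0 := by
    intro y j; simp only [φ, LinearMap.pi_apply]; split_ifs <;> simp
  have hnt : ∀ k, (P k).comap φ ≠ ⊤ := by
    intro k hk
    have hmem : ∀ j ∈ T, (Pi.single j 1 : Fin d → ℝ) ∈ P k := by
      intro j hj
      have : Pi.single j (s j)⁻¹ ∈ (P k).comap φ := by rw [hk]; trivial
      have h2 : φ (Pi.single j (s j)⁻¹) = Pi.single j 1 := by
        ext i
        rw [hφ]
        by_cases hij : i = j
        · subst hij; simp [hj, hs]
        · simp [hij]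
      rw [← h2]; exact this
    have hli : LinearIndependent ℝ (fun j : T => (⟨Pi.single (j:Fin d) 1, hmem j j.2⟩ : P k)) := by
      have h3 : LinearIndependent ℝ (fun j : T => (Pi.single (j:Fin d) (1:ℝ) : Fin d → ℝ)) := by
        have := (Pi.basisFun ℝ (Fin d)).linearIndependent.comp (fun j : T => (j : Fin d)) Subtype.val_injective
        convert this using 2 with j
        simp
      exact LinearIndependent.of_comp (P k).subtype h3
    have := hli.fintype_card_le_finrank
    have := hP k
    simp at *
    omega
  let O : Set (Fin d → ℝ) := Set.pi univ fun _ => Ioi 0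
  have hO : IsOpen O := isOpen_set_pi finite_univ fun _ _ => isOpen_Ioi
  have hOne : O.Nonempty := ⟨fun _ => 1, fun _ _ => by simp⟩
  have hpos : 0 < volume O := hO.measure_pos volume hOne
  have hnull : volume (⋃ k, ((P k).comap φ : Set (Fin d → ℝ))) = 0 :=
    measure_iUnion_null fun k => Measure.addHaar_submodule volume _ (hnt k)
  obtain ⟨y, hyO, hy⟩ : ∃ y ∈ O, y ∉ ⋃ k, ((P k).comap φ : Set (Fin d → ℝ)) := by
    by_contra hcon
    push Not at hcon
    exact hpos.ne' (measure_mono_null hcon hnull)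
  refine ⟨φ y, fun j hj => by simp [hφ, hj], fun j hj => ?_, fun k hk => hy (mem_iUnion.2 ⟨k, hk⟩)⟩
  rw [hφ, if_pos hj, ← mul_assoc]
  have := hyO j trivial
  exact mul_pos (mul_self_pos.2 (hs j)) this

theorem exists_vectors {d m : ℕ} {I : Type*} [Fintype I] (T : I → Finset (Fin d))
    (hT : ∀ i, m + 1 ≤ (T i).card) (s : I → Fin d → ℝ) (hs : ∀ i j, s i j ≠ 0) :
    ∃ w : I → Fin d → ℝ, (∀ i, ∀ j ∉ T i, w i j = 0) ∧ (∀ i, ∀ j ∈ T i, 0 < s i j * w i j) ∧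
      ∀ S : Finset I, S.card ≤ m + 1 → LinearIndepOn ℝ w (S : Set I) := by
  classical
  suffices h : ∀ A : Finset I, ∃ w : I → Fin d → ℝ, (∀ i ∈ A, ∀ j ∉ T i, w i j = 0) ∧
      (∀ i ∈ A, ∀ j ∈ T i, 0 < s i j * w i j) ∧
      ∀ S : Finset I, S ⊆ A → S.card ≤ m + 1 → LinearIndepOn ℝ w (S : Set I) by
    obtain ⟨w, h1, h2, h3⟩ := h Finset.univ
    exact ⟨w, fun i => h1 i (Finset.mem_univ _), fun i => h2 i (Finset.mem_univ _),
      fun S => h3 S (Finset.subset_univ _)⟩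
  intro A
  induction A using Finset.induction_on with
  | empty =>
    refine ⟨fun _ _ => 0, by simp, by simp, fun S hS _ => ?_⟩
    rw [Finset.subset_empty.1 hS]; simp
  | insert a A ha ih =>
    obtain ⟨w, h1, h2, h3⟩ := ih
    obtain ⟨v, v1, v2, v3⟩ := exists_vector (m := m)
      (fun S : {S : Finset I // S.card ≤ m} => Submodule.span ℝ ((S.1.image w : Finset _) : Set (Fin d → ℝ)))
      (fun S => (finrank_span_finset_le_card _).trans (Finset.card_image_le.trans S.2)) (T a) (hT a) (s a) (hs a)
    have hne : ∀ i ∈ A, i ≠ a := fun i hi h => ha (h ▸ hi)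
    refine ⟨Function.update w a v, ?_, ?_, ?_⟩
    · intro i hi
      rcases Finset.mem_insert.1 hi with rfl | hi
      · simpa using v1
      · rw [Function.update_of_ne (hne i hi)]; exact h1 i hi
    · intro i hi
      rcases Finset.mem_insert.1 hi with rfl | hi
      · simpa using v2
      · rw [Function.update_of_ne (hne i hi)]; exact h2 i hi
    · intro S hS hc
      have hcongr : ∀ R : Finset I, R ⊆ A → R.card ≤ m + 1 →
          LinearIndepOn ℝ (Function.update w a v) (R : Set I) := by
        intro R hR hRc
        refine (h3 R hR hRc).congr fun i hi => ?_
        rw [Function.update_of_ne (hne i (hR hi))]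
      by_cases haS : a ∈ S
      · have hE : S.erase a ⊆ A := by
          intro i hi
          have := hS (Finset.mem_of_mem_erase hi)
          exact (Finset.mem_insert.1 this).resolve_left (Finset.ne_of_mem_erase hi)
        have hEc : (S.erase a).card ≤ m := by rw [Finset.card_erase_of_mem haS]; omega
        have := (hcongr _ hE (by omega)).insert (x := a) (by
          rw [Function.update_self]
          have h5 := v3 ⟨S.erase a, hEc⟩
          have h6 : Function.update w a v '' (↑(S.erase a) : Set I) = ((S.erase a).image w : Finset _) := by
            rw [Finset.coe_image]
            exact image_congr fun i hi => Function.update_of_ne (hne i (hE hi)) _ _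
          rw [h6]; exact h5)
        rwa [← Finset.coe_insert, Finset.insert_erase haS] at this
      · refine hcongr S (fun i hi => ?_) hc
        exact (Finset.mem_insert.1 (hS hi)).resolve_left (fun h => haS (h ▸ hi))

/-- **Covering corollary for the cube** (Matdinov, Corollary 1, a generalization of the
Lebesgue theorem). Let `d ≥ 1` and `m ≥ 0`, and let `(C_i)_{i∈I}` be a finite family of
closed subsets of the cube `[0,1]^d` covering the cube, such that every point of the cube
belongs to at most `m+1` of the sets.  Then some `C_i` intersects at least `d−m` pairs of
opposite facets of the cube. -/
theorem cover_touches_many_pairs_of_opposite_facets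
    (d m : ℕ) (hd : 1 ≤ d) (I : Type) [Fintype I]
    (C : I → Set (Fin d → ℝ))
    (hclosed : ∀ i, IsClosed (C i))
    (hsub : ∀ i, C i ⊆ Set.Icc 0 1)
    (hcover : Set.Icc (0 : Fin d → ℝ) 1 ⊆ ⋃ i, C i)
    (hmult : ∀ x ∈ Set.Icc (0 : Fin d → ℝ) 1, {i | x ∈ C i}.ncard ≤ m + 1) :
    ∃ i : I, ∃ J : Finset (Fin d), d - m ≤ J.card ∧
      ∀ j ∈ J, (∃ x ∈ C i, x j = 0) ∧ (∃ x ∈ C i, x j = 1) := by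
  classical
  by_contra hcon
  push Not at hcon
  set Q := Icc (0 : Fin d → ℝ) 1 with hQ
  -- the coordinates in which `C i` fails to touch one of the two facets
  let T : I → Finset (Fin d) := fun i =>
    Finset.univ.filter fun j => ¬ ((∃ x ∈ C i, x j = 0) ∧ (∃ x ∈ C i, x j = 1))
  have hT : ∀ i, m + 1 ≤ (T i).card := by
    intro i
    by_contra hlt
    have hc := Finset.card_compl (T i)
    rw [Fintype.card_fin] at hc
    obtain ⟨j, hj, h1⟩ := hcon i (T i)ᶜ (by omega)
    have : (∃ x ∈ C i, x j = 0) ∧ (∃ x ∈ C i, x j = 1) := by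
      simpa only [T, Finset.mem_compl, Finset.mem_filter, Finset.mem_univ, true_and, not_not]
        using hj
    obtain ⟨y, hy, hy1⟩ := this.2
    exact h1 this.1 y hy hy1
  let s : I → Fin d → ℝ := fun i j => if ∃ x ∈ C i, x j = 0 then -1 else 1
  have hs : ∀ i j, s i j ≠ 0 := by
    intro i j; simp only [s]; split_ifs <;> norm_num
  obtain ⟨w, w1, w2, w3⟩ := exists_vectors T hT s hs
  have hw0 : ∀ i j, (∃ x ∈ C i, x j = 0) → w i j ≤ 0 := by
    intro i j h
    by_cases hj : j ∈ T i
    · have := w2 i j hj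
      simp only [s, if_pos h] at this
      linarith
    · exact (w1 i j hj).le
  have hw1 : ∀ i j, (∃ x ∈ C i, x j = 1) → 0 ≤ w i j := by
    intro i j h
    by_cases hj : j ∈ T i
    · have h2 := w2 i j hj
      have h3 : ¬ ∃ x ∈ C i, x j = 0 := by
        intro h0
        simp only [T, Finset.mem_filter, Finset.mem_univ, true_and] at hj
        exact hj ⟨h0, h⟩
      simp only [s, if_neg h3] at h2
      linarith
    · exact (w1 i j hj).ge
  -- thicken the sets
  have hQc : IsCompact Q := isCompact_Icc
  let D : (I ⊕ (Fin d ⊕ Fin d)) ⊕ Unit → Set (Fin d → ℝ) :=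
    Sum.elim (Sum.elim C (Sum.elim (fun j => {x | x j = 0}) (fun j => {x | x j = 1}))) (fun _ => Q)
  have hD : ∀ k, IsClosed (D k) := by
    rintro ((i | (j | j)) | _)
    · exact hclosed i
    · exact isClosed_eq (continuous_apply j) continuous_const
    · exact isClosed_eq (continuous_apply j) continuous_const
    · exact hQc.isClosed
  obtain ⟨δ, hδ, hthick⟩ := exists_thick Q hQc D hD
  let U : I → Set (Fin d → ℝ) := fun i => Metric.thickening δ (C i)
  have hU : ∀ y ∈ Q, ∃ x ∈ Q, (∀ i, y ∈ U i → x ∈ C i) ∧ (∀ j, y j = 0 → x j = 0) ∧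
      (∀ j, y j = 1 → x j = 1) := by
    intro y hy
    obtain ⟨x, hx⟩ := hthick y hy
    refine ⟨x, hx (Sum.inr ()) (Metric.self_subset_thickening hδ _ hy),
      fun i hi => hx (Sum.inl (Sum.inl i)) hi,
      fun j hj => hx (Sum.inl (Sum.inr (Sum.inl j))) (Metric.self_subset_thickening hδ _ hj),
      fun j hj => hx (Sum.inl (Sum.inr (Sum.inr j))) (Metric.self_subset_thickening hδ _ hj)⟩
  have hlam : ∀ i, ∃ f : (Fin d → ℝ) → ℝ, f.support = U i ∧ ContDiff ℝ 1 f ∧ range f ⊆ Icc 0 1 := by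
    intro i
    exact IsOpen.exists_contDiff_support_eq (n := 1) Metric.isOpen_thickening
  choose l hl1 hl2 hl3 using hlam
  have hlmem : ∀ i x, l i x ≠ 0 → x ∈ U i := fun i x h => by rw [← hl1 i]; exact h
  have hlnn : ∀ i x, 0 ≤ l i x := fun i x => (hl3 i ⟨x, rfl⟩).1
  let f : (Fin d → ℝ) → (Fin d → ℝ) := fun x => ∑ i, l i x • w i
  have hf : ContDiff ℝ 1 f := ContDiff.sum fun i _ => (hl2 i).smul contDiff_const
  have hfj : ∀ x j, f x j = ∑ i, l i x * w i j := by
    intro x j; simp [f, Finset.sum_apply]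
  have hf0 : ∀ x ∈ Q, ∀ j, x j = 0 → f x j ≤ 0 := by
    intro x hx j hj
    obtain ⟨y, hy, y1, y2, y3⟩ := hU x hx
    rw [hfj]
    refine Finset.sum_nonpos fun i _ => ?_
    by_cases h : l i x = 0
    · simp [h]
    · exact mul_nonpos_of_nonneg_of_nonpos (hlnn i x) (hw0 i j ⟨y, y1 i (hlmem i x h), y2 j hj⟩)
  have hf1 : ∀ x ∈ Q, ∀ j, x j = 1 → 0 ≤ f x j := by
    intro x hx j hj
    obtain ⟨y, hy, y1, y2, y3⟩ := hU x hx
    rw [hfj]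
    refine Finset.sum_nonneg fun i _ => ?_
    by_cases h : l i x = 0
    · simp [h]
    · exact mul_nonneg (hlnn i x) (hw1 i j ⟨y, y1 i (hlmem i x h), y3 j hj⟩)
  have hfne : ∀ x ∈ Q, f x ≠ 0 := by
    intro x hx hfx
    obtain ⟨y, hy, y1, -, -⟩ := hU x hx
    let S : Finset I := Finset.univ.filter fun i => y ∈ C i
    have hS : S.card ≤ m + 1 := by
      have := hmult y hy
      rwa [show {i | y ∈ C i} = (S : Set I) by ext i; simp [S], Set.ncard_coe_finset] at this
    have hli := w3 S hS
    rw [linearIndepOn_finset_iff] at hli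
    have hsum : ∑ i ∈ S, l i x • w i = 0 := by
      rw [← hfx]
      refine Finset.sum_subset (Finset.subset_univ _) fun i _ hi => ?_
      have : l i x = 0 := by
        by_contra h
        exact hi (by simp only [S, Finset.mem_filter, Finset.mem_univ, true_and]; exact y1 i (hlmem i x h))
      simp [this]
    obtain ⟨i, hi⟩ := mem_iUnion.1 (hcover hx)
    have hxi : x ∈ U i := Metric.self_subset_thickening hδ _ hi
    have hli0 := hli (fun i => l i x) hsum i (by simpa [S] using y1 i hxi)
    have : x ∈ (l i).support := by rw [hl1 i]; exact hxi
    exact this hli0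
  have hQne : Q.Nonempty := ⟨0, ⟨le_refl _, zero_le_one⟩⟩
  obtain ⟨x₀, hx₀, hmin⟩ := hQc.exists_isMinOn hQne (hf.continuous.norm.continuousOn)
  set c := ‖f x₀‖ with hc
  have hcpos : 0 < c := norm_pos_iff.2 (hfne x₀ hx₀)
  have hbig : ∀ x ∈ Q, ∃ j, c ≤ |f x j| := by
    intro x hx
    by_contra hlt
    push Not at hlt
    have h2 : ‖f x‖ < c := (pi_norm_lt_iff hcpos).2 hlt
    exact absurd (hmin hx) (not_le.2 h2)
  -- the final map
  let G : (Fin d → ℝ) → Fin d → ℝ := fun x j => (f x j + (c / 2) * (2 * x j - 1)) / c + 1 / 2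
  let F : (Fin d → ℝ) → Fin d → ℝ := fun x j => Real.smoothTransition (G x j)
  have hF : ContDiff ℝ 1 F := by
    refine contDiff_pi.2 fun j => ?_
    refine Real.smoothTransition.contDiff.comp ?_
    have h1 : ContDiff ℝ 1 fun x => f x j := contDiff_pi.1 hf j
    have h2 : ContDiff ℝ 1 fun x : Fin d → ℝ => x j := contDiff_apply ℝ ℝ j
    exact ((h1.add (contDiff_const.mul ((contDiff_const.mul h2).sub contDiff_const))).div_const c).add
      contDiff_const
  have hle : ∀ x j, f x j + (c / 2) * (2 * x j - 1) ≤ -(c/2) → F x j = 0 := by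
    intro x j h
    refine Real.smoothTransition.zero_of_nonpos ?_
    have := div_le_div_of_nonneg_right h hcpos.le
    have e : -(c/2)/c = -(1/2) := by field_simp
    simp only [G]
    linarith
  have hge : ∀ x j, c/2 ≤ f x j + (c / 2) * (2 * x j - 1) → F x j = 1 := by
    intro x j h
    refine Real.smoothTransition.one_of_one_le ?_
    have := div_le_div_of_nonneg_right h hcpos.le
    have e : (c/2)/c = 1/2 := by field_simp
    simp only [G]
    linarith
  obtain ⟨x, hx, hxF⟩ := exists_not_zero_one F hF
    (fun x j => ⟨Real.smoothTransition.nonneg _, Real.smoothTransition.le_one _⟩)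
    (fun x hx j hj => hle x j (by rw [hj]; have := hf0 x hx j hj; linarith))
    (fun x hx j hj => hge x j (by rw [hj]; have := hf1 x hx j hj; linarith))
  obtain ⟨j, hj⟩ := hbig x hx
  have a : 0 ≤ x j := hx.1 j
  have b : x j ≤ 1 := hx.2 j
  rcases le_abs'.1 hj with h | h
  · exact (hxF j).1 (hle x j (by nlinarith))
  · exact (hxF j).2 (hge x j (by nlinarith))
end

section
/- Let d ≥ 1 and 0 ≤ m ≤ d be integers and let (C_i)_{i∈I} be a finite family of open subsets of the torus T^d = (ℝ/ℤ)^d whose union is T^d and such that every point of T^d belongs to at most m+1 of the sets. Then for some index i the image of H_1(C_i) in H_1(T^d) = ℤ^d has rank at least d−m; concretely, there exist continuous maps γ_1,…,γ_{d−m} : ℝ → ℝ^d and vectors v_1,…,v_{d−m} ∈ ℤ^d such that for each l: γ_l(t+1) = γ_l(t) + v_l for all t ∈ ℝ, the projection of γ_l(t) to T^d lies in C_i for all t ∈ ℝ, and the vectors v_1,…,v_{d−m} are linearly independent over ℚ. -/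
namespace TorusCover

open MeasureTheory Set Filter Topology


/-- the integer vector as a real vector -/
def zc {d : ℕ} (v : Fin d → ℤ) : Fin d → ℝ := fun j => (v j : ℝ)

lemma exists_rep {d : ℕ} (x : Fin d → ℝ) :
    ∃ y ∈ Set.Icc (0 : Fin d → ℝ) 1, ∃ v : Fin d → ℤ, x = y + zc v := by
  refine ⟨fun j => Int.fract (x j), ⟨fun j => Int.fract_nonneg _, fun j => (Int.fract_lt_one _).le⟩,
    fun j => ⌊x j⌋, ?_⟩
  ext j
  simp [zc, Int.fract_add_floor]

/-- determinants of affine families are interpolated -/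
lemma det_interp {d : ℕ} (t : ℕ → ℝ) (ht : Function.Injective t) :
    ∃ L : ℕ → ℝ, ∑ k ∈ Finset.range (d + 1), L k = 1 ∧
      ∀ A : (Fin d → ℝ) →L[ℝ] (Fin d → ℝ),
        (ContinuousLinearMap.id ℝ (Fin d → ℝ) + A).det =
          ∑ k ∈ Finset.range (d + 1), L k * (ContinuousLinearMap.id ℝ (Fin d → ℝ) + t k • A).det := by
  refine ⟨fun k => (Lagrange.basis (Finset.range (d + 1)) t k).eval 1, ?_, ?_⟩
  · rw [← Polynomial.eval_finsetSum, Lagrange.sum_basis ht.injOn ⟨0, by simp⟩]; simp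
  · intro A
    set M : Matrix (Fin d) (Fin d) ℝ := LinearMap.toMatrix' (A : (Fin d → ℝ) →ₗ[ℝ] (Fin d → ℝ)) with hM
    set p : Polynomial ℝ := Matrix.det ((Polynomial.X : Polynomial ℝ) • M.map Polynomial.C
      + (1 : Matrix (Fin d) (Fin d) ℝ).map Polynomial.C) with hp
    have hdeg : p.natDegree ≤ d := by
      have := Polynomial.natDegree_det_X_add_C_le M 1
      rwa [Fintype.card_fin] at this
    have hev : ∀ s : ℝ, p.eval s = (ContinuousLinearMap.id ℝ (Fin d → ℝ) + s • A).det := by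
      intro s
      have h2 : (ContinuousLinearMap.id ℝ (Fin d → ℝ) + s • A).det
          = Matrix.det (1 + s • M) := by
        rw [ContinuousLinearMap.det, ← LinearMap.det_toMatrix']
        congr 1
        simp [hM]
      rw [h2, hp, ← Polynomial.coe_evalRingHom, RingHom.map_det]
      congr 1
      ext i j
      by_cases hij : i = j <;> simp [hij, add_comm] <;> ring
    have := Lagrange.eq_interpolate (s := Finset.range (d + 1)) (v := t) (f := p) ht.injOn (by
      rw [Finset.card_range]
      exact lt_of_le_of_lt Polynomial.degree_le_natDegree (by exact_mod_cast Nat.lt_succ_of_le hdeg))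
    have h1 := hev 1
    rw [one_smul] at h1
    rw [← h1]
    conv_lhs => rw [this]
    rw [Lagrange.interpolate_apply, Polynomial.eval_finsetSum]
    refine Finset.sum_congr rfl fun k _ => ?_
    rw [← hev]
    simp [mul_comm]

lemma degree_pos {d : ℕ} (g : (Fin d → ℝ) → (Fin d → ℝ)) (hg : ContDiff ℝ 1 g)
    (hper : ∀ x v, g (x + zc v) = g x) :
    ∃ x, (ContinuousLinearMap.id ℝ (Fin d → ℝ) + fderiv ℝ g x).det ≠ 0 := by
  classical
  by_contra! hcon
  set D : Set (Fin d → ℝ) := ZSpan.fundamentalDomain (Pi.basisFun ℝ (Fin d)) with hD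
  have hDm : MeasurableSet D := ZSpan.fundamentalDomain_measurableSet _
  have hDvol : volume D = 1 := by
    rw [hD, ZSpan.volume_fundamentalDomain]
    have : (Matrix.of (Pi.basisFun ℝ (Fin d)) : Matrix (Fin d) (Fin d) ℝ) = 1 := by
      ext i j
      simp [Matrix.one_apply, Pi.single_apply, eq_comm]
    rw [this]; simp
  have hcont : Continuous (fderiv ℝ g) := hg.continuous_fderiv (by simp)
  have hdper : ∀ x v, fderiv ℝ g (x + zc v) = fderiv ℝ g x := by
    intro x v
    have : (fun y => g (y + zc v)) = g := funext fun y => hper y v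
    rw [← fderiv_comp_add_right, this]
  obtain ⟨M, hM⟩ : ∃ M : ℝ, ∀ x, ‖fderiv ℝ g x‖ ≤ M := by
    obtain ⟨M, hM⟩ := (isCompact_Icc (a := (0 : Fin d → ℝ)) (b := 1)).exists_bound_of_continuousOn
      hcont.continuousOn
    refine ⟨M, fun x => ?_⟩
    obtain ⟨y, hy, v, rfl⟩ := exists_rep x
    rw [hdper]; exact hM y hy
  have hM0 : 0 ≤ M := (norm_nonneg _).trans (hM 0)
  -- small perturbations of the identity have positive determinant
  obtain ⟨δ, hδ, hdet⟩ : ∃ δ > 0, ∀ B : (Fin d → ℝ) →L[ℝ] (Fin d → ℝ), ‖B‖ < δ →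
      0 < (ContinuousLinearMap.id ℝ (Fin d → ℝ) + B).det := by
    have hc : Continuous fun B : (Fin d → ℝ) →L[ℝ] (Fin d → ℝ) =>
        (ContinuousLinearMap.id ℝ (Fin d → ℝ) + B).det :=
      ContinuousLinearMap.continuous_det.comp (continuous_const.add continuous_id)
    have h0 : (0 : ℝ) < (ContinuousLinearMap.id ℝ (Fin d → ℝ) + 0).det := by
      simp [ContinuousLinearMap.det]
    obtain ⟨δ, hδ, h⟩ := Metric.eventually_nhds_iff.1 (hc.continuousAt.eventually (lt_mem_nhds h0))
    exact ⟨δ, hδ, fun B hB => h (by simpa using hB)⟩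
  set ε : ℝ := min δ 1 / (2 * (M + 1)) with hε
  have hε0 : 0 < ε := by positivity
  have hεM : ε * M < min δ 1 := by
    have : 0 < min δ 1 := by positivity
    rw [hε, div_mul_eq_mul_div, div_lt_iff₀ (by positivity)]
    nlinarith
  have key : ∀ t : ℝ, 0 < t → t ≤ ε →
      ∫ x in D, (ContinuousLinearMap.id ℝ (Fin d → ℝ) + t • fderiv ℝ g x).det = 1 := by
    intro t ht0 ht
    have htM : t * M < min δ 1 := lt_of_le_of_lt (by gcongr) hεM
    set F : (Fin d → ℝ) → (Fin d → ℝ) := fun x => x + t • g x with hF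
    have hder : ∀ x, HasFDerivAt F (ContinuousLinearMap.id ℝ (Fin d → ℝ) + t • fderiv ℝ g x) x := by
      intro x
      exact (hasFDerivAt_id x).add ((hg.differentiable (by simp) x).hasFDerivAt.const_smul t)
    have hlip : LipschitzWith (Real.toNNReal (t * M)) (fun x => t • g x) := by
      apply lipschitzWith_of_nnnorm_fderiv_le (𝕜 := ℝ) ((hg.differentiable (by simp)).const_smul t)
      intro x
      rw [fderiv_const_smul (hg.differentiable (by simp) x)]
      rw [← NNReal.coe_le_coe, coe_nnnorm, Real.coe_toNNReal _ (by positivity), norm_smul, Real.norm_of_nonneg ht0.le]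
      gcongr
      exact hM x
    have hap : ApproximatesLinearOn F
        ((ContinuousLinearEquiv.refl ℝ (Fin d → ℝ) : (Fin d → ℝ) ≃L[ℝ] (Fin d → ℝ)) : (Fin d → ℝ) →L[ℝ] (Fin d → ℝ)) univ (Real.toNNReal (t * M)) := by
      intro x _ y _
      have := hlip.norm_sub_le x y
      simpa [hF, add_sub_add_comm] using this
    have hc : Subsingleton (Fin d → ℝ) ∨ Real.toNNReal (t * M) <
        ‖(((ContinuousLinearEquiv.refl ℝ (Fin d → ℝ)).symm : (Fin d → ℝ) ≃L[ℝ] (Fin d → ℝ)) : (Fin d → ℝ) →L[ℝ] (Fin d → ℝ))‖₊⁻¹ := by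
      rcases subsingleton_or_nontrivial (Fin d → ℝ) with h | h
      · exact Or.inl h
      · right
        have : ‖(((ContinuousLinearEquiv.refl ℝ (Fin d → ℝ)).symm : (Fin d → ℝ) ≃L[ℝ] (Fin d → ℝ)) : (Fin d → ℝ) →L[ℝ] (Fin d → ℝ))‖₊ = 1 := by
          rw [← NNReal.coe_inj]
          exact ContinuousLinearMap.norm_id
        rw [this, inv_one, Real.toNNReal_lt_one]
        exact htM.trans_le (min_le_right _ _)
    have hsurj : Function.Surjective F := hap.surjective hc
    have hinj : Function.Injective F := Set.injOn_univ.1 (hap.injOn hc)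
    have hFc : Continuous F := continuous_iff_continuousAt.2 fun x => (hder x).continuousAt
    have himg : volume (F '' D) = 1 := by
      have h1 : IsAddFundamentalDomain (Submodule.span ℤ (Set.range (Pi.basisFun ℝ (Fin d)))).toAddSubgroup D volume :=
        ZSpan.isAddFundamentalDomain' _ _
      have h2 : IsAddFundamentalDomain (Submodule.span ℤ (Set.range (Pi.basisFun ℝ (Fin d)))).toAddSubgroup (F '' D) volume := by
        apply IsAddFundamentalDomain.mk'
        · exact (hDm.image_of_continuousOn_injOn hFc.continuousOn hinj.injOn).nullMeasurableSet
        · intro y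
          obtain ⟨x, rfl⟩ := hsurj y
          have hequi : ∀ w : (Submodule.span ℤ (Set.range (Pi.basisFun ℝ (Fin d)))).toAddSubgroup, w +ᵥ F x = F (w +ᵥ x) := by
            rintro ⟨w, hw⟩
            obtain ⟨v, rfl⟩ : ∃ v : Fin d → ℤ, w = zc v := by
              have hw' := ((Pi.basisFun ℝ (Fin d)).mem_span_iff_repr_mem ℤ w).1 hw
              choose v hv using hw'
              refine ⟨v, ?_⟩
              ext j
              simpa [zc] using (hv j).symm
            simp only [hF, AddSubgroup.vadd_def, vadd_eq_add]
            rw [add_comm (zc v) x, hper]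
            abel
          obtain ⟨w, hw, hu⟩ := ZSpan.exist_unique_vadd_mem_fundamentalDomain (Pi.basisFun ℝ (Fin d)) x
          refine ⟨w, ?_, ?_⟩
          · show _ ∈ _
            rw [hequi]
            exact ⟨_, hw, rfl⟩
          · intro w' hw'
            simp only [hequi] at hw'
            exact hu w' ((hinj.mem_set_image).1 hw')
      have : Countable (Submodule.span ℤ (Set.range (Pi.basisFun ℝ (Fin d)))).toAddSubgroup :=
        inferInstanceAs (Countable (Submodule.span ℤ (Set.range (Pi.basisFun ℝ (Fin d)))))
      rw [← hDvol]
      exact h2.measure_eq h1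
    have hlint := lintegral_abs_det_fderiv_eq_addHaar_image volume hDm
      (fun x _ => (hder x).hasFDerivWithinAt) hinj.injOn
    rw [himg] at hlint
    have hpos : ∀ x, 0 < (ContinuousLinearMap.id ℝ (Fin d → ℝ) + t • fderiv ℝ g x).det := by
      intro x
      apply hdet
      rw [norm_smul, Real.norm_of_nonneg ht0.le]
      exact lt_of_le_of_lt (by gcongr; exact hM x) (htM.trans_le (min_le_left _ _))
    rw [integral_eq_lintegral_of_nonneg_ae (Eventually.of_forall fun x => (hpos x).le)]
    · simp only [abs_of_pos (hpos _)] at hlint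
      rw [hlint]; simp
    · exact (ContinuousLinearMap.continuous_det.comp (continuous_const.add (hcont.const_smul t))).aestronglyMeasurable
  -- interpolation
  obtain ⟨L, hL1, hL⟩ := det_interp (d := d) (fun k : ℕ => ε / (k + 1)) (by
    intro a b hab
    simp only at hab
    rw [div_eq_div_iff (by positivity) (by positivity)] at hab
    have := mul_left_cancel₀ hε0.ne' hab
    have h3 : (b : ℝ) = a := by linarith
    exact_mod_cast h3.symm)
  have hint : ∀ t : ℝ, IntegrableOn (fun x => (ContinuousLinearMap.id ℝ (Fin d → ℝ) + t • fderiv ℝ g x).det) D := by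
    intro t
    have hc : Continuous (fun x => (ContinuousLinearMap.id ℝ (Fin d → ℝ) + t • fderiv ℝ g x).det) :=
      ContinuousLinearMap.continuous_det.comp (continuous_const.add (hcont.const_smul t))
    refine (hc.continuousOn.integrableOn_compact (isCompact_Icc (a := (0 : Fin d → ℝ)) (b := 1))).mono_set ?_
    intro x hx
    rw [hD, ZSpan.fundamentalDomain_pi_basisFun] at hx
    exact ⟨fun j => (hx j trivial).1, fun j => (hx j trivial).2.le⟩
  have : (0 : ℝ) = 1 := by
    calc (0 : ℝ) = ∫ x in D, (ContinuousLinearMap.id ℝ (Fin d → ℝ) + fderiv ℝ g x).det := by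
          simp [hcon]
      _ = ∫ x in D, ∑ k ∈ Finset.range (d + 1), L k * (ContinuousLinearMap.id ℝ (Fin d → ℝ) + (ε / ((k : ℝ) + 1)) • fderiv ℝ g x).det := by
          congr 1; ext x; rw [hL]
      _ = ∑ k ∈ Finset.range (d + 1), L k * ∫ x in D, (ContinuousLinearMap.id ℝ (Fin d → ℝ) + (ε / ((k : ℝ) + 1)) • fderiv ℝ g x).det := by
          rw [integral_finsetSum _ (fun k _ => (hint _).const_mul _)]
          simp only [integral_const_mul]
      _ = 1 := by
          rw [← hL1]
          refine Finset.sum_congr rfl fun k _ => ?_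
          rw [key _ (by positivity) (div_le_self hε0.le (by linarith [(Nat.cast_nonneg k : (0 : ℝ) ≤ k)])), mul_one]
  exact zero_ne_one this

/-- iterated partial projections -/
noncomputable def Yit {E : Type*} [NormedAddCommGroup E] [NormedSpace ℝ E] (s : ℕ → E → ℝ)
    (P : ℕ → E → (E →L[ℝ] E)) (q : ℕ → E → E) : ℕ → E → E
  | 0 => fun x => x
  | k + 1 => fun x => Yit s P q k x + s k x • (P k x (Yit s P q k x) + q k x - Yit s P q k x)

lemma core {d m : ℕ} (s : ℕ → (Fin d → ℝ) → ℝ)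
    (P : ℕ → (Fin d → ℝ) → ((Fin d → ℝ) →L[ℝ] (Fin d → ℝ))) (q : ℕ → (Fin d → ℝ) → (Fin d → ℝ))
    (hs : ∀ j, ContDiff ℝ 1 (s j))
    (hsper : ∀ j x v, s j (x + zc v) = s j x)
    (hloc : ∀ j x, (∀ᶠ y in 𝓝 x, s j y = 0) ∨ ∃ P0 q0, ∀ᶠ y in 𝓝 x, P j y = P0 ∧ q j y = q0)
    (hequiv : ∀ j x v, s j x ≠ 0 →
      P j (x + zc v) = P j x ∧ q j (x + zc v) = q j x + (zc v - P j x (zc v)))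
    (hrank : ∀ j x, Module.finrank ℝ (LinearMap.range (P j x : (Fin d → ℝ) →ₗ[ℝ] (Fin d → ℝ))) + m < d)
    (hone : ∀ x, ∃ j ≤ m, ∀ᶠ y in 𝓝 x, s j y = 1) : False := by
  set Y := Yit s P q with hY
  have hYs : ∀ k x, Y (k + 1) x = Y k x + s k x • (P k x (Y k x) + q k x - Y k x) := fun k x => rfl
  have hYc : ∀ k, ContDiff ℝ 1 (Y k) := by
    intro k
    induction k with
    | zero => exact contDiff_id
    | succ k ih =>
      rw [contDiff_iff_contDiffAt]
      intro x
      rcases hloc k x with h | ⟨P0, q0, h⟩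
      · refine ih.contDiffAt.congr_of_eventuallyEq ?_
        filter_upwards [h] with y hy
        rw [hYs, hy]; simp
      · have : ContDiffAt ℝ 1 (fun y => Y k y + s k y • (P0 (Y k y) + q0 - Y k y)) x := by
          have h1 := ih.contDiffAt (x := x)
          have h2 := (hs k).contDiffAt (x := x)
          have h3 : ContDiffAt ℝ 1 (fun y => P0 (Y k y)) x := P0.contDiff.contDiffAt.comp x h1
          exact h1.add (h2.smul ((h3.add contDiffAt_const).sub h1))
        refine this.congr_of_eventuallyEq ?_
        filter_upwards [h] with y hy
        rw [hYs, hy.1, hy.2]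
  have hYe : ∀ k x v, Y k (x + zc v) = Y k x + zc v := by
    intro k x v
    induction k with
    | zero => rfl
    | succ k ih =>
      rw [hYs, hYs, hsper, ih]
      by_cases h : s k x = 0
      · simp [h]
      · obtain ⟨h1, h2⟩ := hequiv k x v h
        rw [h1, h2, map_add]
        have : P k x (Y k x) + P k x (zc v) + (q k x + (zc v - P k x (zc v))) - (Y k x + zc v)
          = P k x (Y k x) + q k x - Y k x := by abel
        rw [this]; abel
  have hYd : ∀ k x, HasFDerivAt (Y k) (fderiv ℝ (Y k) x) x := fun k x =>
    ((hYc k).differentiable (by simp) x).hasFDerivAt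
  have hsd : ∀ k x, HasFDerivAt (s k) (fderiv ℝ (s k) x) x := fun k x =>
    ((hs k).differentiable (by simp) x).hasFDerivAt
  have hstep : ∀ k x w, fderiv ℝ (Y k) x w = 0 → fderiv ℝ (s k) x w = 0 →
      fderiv ℝ (Y (k + 1)) x w = 0 := by
    intro k x w h1 h2
    rcases hloc k x with h | ⟨P0, q0, h⟩
    · have : Y (k + 1) =ᶠ[𝓝 x] Y k := by
        filter_upwards [h] with y hy
        rw [hYs, hy]; simp
      rw [this.fderiv_eq, h1]
    · have : Y (k + 1) =ᶠ[𝓝 x] (fun y => Y k y + s k y • (P0 (Y k y) + q0 - Y k y)) := by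
        filter_upwards [h] with y hy
        rw [hYs, hy.1, hy.2]
      have hd : HasFDerivAt (fun y => Y k y + s k y • (P0 (Y k y) + q0 - Y k y)) _ x :=
        (hYd k x).add ((hsd k x).smul (((P0.hasFDerivAt.comp x (hYd k x)).add_const q0).sub (hYd k x)))
      rw [this.fderiv_eq, hd.fderiv]
      simp [h1, h2]
  obtain ⟨x, hx⟩ := degree_pos (fun x => Y (m + 1) x - x) ((hYc _).sub contDiff_id) (by
    intro x v
    simp only [hYe]; abel)
  apply hx
  have hF : ContinuousLinearMap.id ℝ (Fin d → ℝ) + fderiv ℝ (fun x => Y (m + 1) x - x) x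
      = fderiv ℝ (Y (m + 1)) x := by
    have h0 : HasFDerivAt (fun x => Y (m + 1) x - x)
        (fderiv ℝ (Y (m + 1)) x - ContinuousLinearMap.id ℝ (Fin d → ℝ)) x :=
      (hYd (m + 1) x).sub (hasFDerivAt_id x)
    rw [h0.fderiv]
    abel
  rw [hF]
  obtain ⟨j, hj, h1⟩ := hone x
  obtain ⟨P0, q0, h⟩ : ∃ P0 q0, ∀ᶠ y in 𝓝 x, P j y = P0 ∧ q j y = q0 := by
    rcases hloc j x with h | h
    · have := h.self_of_nhds
      rw [h1.self_of_nhds] at this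
      exact absurd this one_ne_zero
    · exact h
  have hP0 : P j x = P0 := h.self_of_nhds.1
  have hr := hrank j x
  rw [hP0] at hr
  let T : (Fin d → ℝ) →ₗ[ℝ] (LinearMap.range (P0 : (Fin d → ℝ) →ₗ[ℝ] (Fin d → ℝ))) × (Fin m → ℝ) :=
    ((P0 : (Fin d → ℝ) →ₗ[ℝ] (Fin d → ℝ)).rangeRestrict.comp
      (fderiv ℝ (Y j) x : (Fin d → ℝ) →ₗ[ℝ] (Fin d → ℝ))).prod
      (LinearMap.pi fun i : Fin m => (fderiv ℝ (s (j + 1 + i)) x : (Fin d → ℝ) →ₗ[ℝ] ℝ))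
  have hT : LinearMap.ker T ≠ ⊥ := by
    apply LinearMap.ker_ne_bot_of_finrank_lt
    rw [Module.finrank_prod]
    simpa using hr
  obtain ⟨w, hw, hw0⟩ := (Submodule.ne_bot_iff _).1 hT
  have hw1 : P0 (fderiv ℝ (Y j) x w) = 0 := by
    have := congrArg (fun z => (z.1 : Fin d → ℝ)) (LinearMap.mem_ker.1 hw)
    simpa [T] using this
  have hw2 : ∀ i : Fin m, fderiv ℝ (s (j + 1 + i)) x w = 0 := by
    intro i
    have := congrArg (fun z => z.2 i) (LinearMap.mem_ker.1 hw)
    simpa [T] using this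
  have hall : ∀ i, i ≤ m → fderiv ℝ (Y (j + 1 + i)) x w = 0 := by
    intro i
    induction i with
    | zero =>
      intro _
      have : Y (j + 1) =ᶠ[𝓝 x] fun y => P0 (Y j y) + q0 := by
        filter_upwards [h, h1] with y hy hy1
        rw [hYs, hy.1, hy.2, hy1]; simp
      have hd : HasFDerivAt (fun y => P0 (Y j y) + q0) _ x :=
        (P0.hasFDerivAt.comp x (hYd j x)).add_const q0
      rw [add_zero, this.fderiv_eq, hd.fderiv]
      simpa using hw1
    | succ i ih =>
      intro hi
      exact hstep _ _ _ (ih (by omega)) (hw2 ⟨i, by omega⟩)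
  have hfin := hall (m - j) (by omega)
  rw [show j + 1 + (m - j) = m + 1 by omega] at hfin
  rw [ContinuousLinearMap.det, LinearMap.det_eq_zero_iff_ker_ne_bot, Submodule.ne_bot_iff]
  exact ⟨w, hfin, hw0⟩


lemma zc_add {d : ℕ} (u v : Fin d → ℤ) : zc (u + v) = zc u + zc v := by
  ext j; simp [zc]

lemma zc_sub {d : ℕ} (u v : Fin d → ℤ) : zc (u - v) = zc u - zc v := by
  ext j; simp [zc]

lemma zc_zero {d : ℕ} : zc (0 : Fin d → ℤ) = 0 := by
  ext j; simp [zc]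

lemma zc_neg {d : ℕ} (v : Fin d → ℤ) : zc (-v) = -zc v := by
  ext j; simp [zc]

lemma zc_zsmul {d : ℕ} (n : ℤ) (v : Fin d → ℤ) : zc (n • v) = (n : ℝ) • zc v := by
  ext j; simp [zc]

lemma joinedIn_translate {d : ℕ} {S : Set (Fin d → ℝ)} (hper : ∀ x v, x ∈ S → x + zc v ∈ S)
    {x y : Fin d → ℝ} (h : JoinedIn S x y) (v : Fin d → ℤ) :
    JoinedIn S (x + zc v) (y + zc v) := by
  refine (h.map (f := fun z => z + zc v) (by fun_prop)).mono ?_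
  rintro _ ⟨z, hz, rfl⟩
  exact hper z v hz

/-- Locally constant equivariant offsets. -/
lemma exists_offset {d : ℕ} (S : Set (Fin d → ℝ)) (hper : ∀ x v, x ∈ S → x + zc v ∈ S)
    (P : (Fin d → ℝ) →L[ℝ] (Fin d → ℝ))
    (hP : ∀ x v, JoinedIn S x (x + zc v) → P (zc v) = zc v) :
    ∃ q : (Fin d → ℝ) → (Fin d → ℝ), (∀ x y, JoinedIn S x y → q x = q y) ∧
      ∀ x v, x ∈ S → q (x + zc v) = q x + (zc v - P (zc v)) := by
  classical
  let st : Setoid S :=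
    { r := fun x y => ∃ v, JoinedIn S (x.1 + zc v) y.1
      iseqv := by
        refine ⟨fun x => ⟨0, by rw [zc_zero, add_zero]; exact JoinedIn.refl x.2⟩, ?_, ?_⟩
        · rintro x y ⟨v, hv⟩
          refine ⟨-v, ?_⟩
          have := (joinedIn_translate hper hv (-v)).symm
          rwa [add_assoc, ← zc_add, add_neg_cancel, zc_zero, add_zero] at this
        · rintro x y z ⟨v, hv⟩ ⟨w, hw⟩
          refine ⟨v + w, ?_⟩
          have := joinedIn_translate hper hv w
          rw [zc_add, ← add_assoc]
          exact this.trans hw }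
  let r : S → S := fun x => (Quotient.mk st x).out
  have hr : ∀ x : S, ∃ v, JoinedIn S ((r x).1 + zc v) x.1 := fun x => Quotient.mk_out (s := st) x
  choose c hc using hr
  have key : ∀ (x y : S) (u : Fin d → ℤ), JoinedIn S (x.1 + zc u) y.1 →
      zc (c y) - P (zc (c y)) = zc (c x) - P (zc (c x)) + (zc u - P (zc u)) := by
    intro x y u h
    have hrr : r x = r y := by
      have : Quotient.mk st x = Quotient.mk st y := Quotient.sound ⟨u, h⟩
      simp only [r, this]
    have h1 := joinedIn_translate hper (hc x) u
    have h2 := (h1.trans h).trans (hc y).symm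
    rw [← hrr] at h2
    have h3 := hP ((r x).1 + zc (c x) + zc u) (c y - c x - u) (by
      have e : (r x).1 + zc (c x) + zc u + zc (c y - c x - u) = (r x).1 + zc (c y) := by
        rw [zc_sub, zc_sub]; abel
      rw [e]; exact h2)
    rw [zc_sub, zc_sub, map_sub, map_sub] at h3
    have h4 : zc (c y) - P (zc (c y)) - (zc (c x) - P (zc (c x)) + (zc u - P (zc u)))
      = (zc (c y) - zc (c x) - zc u) - (P (zc (c y)) - P (zc (c x)) - P (zc u)) := by abel
    rw [h3, sub_self] at h4
    exact sub_eq_zero.1 h4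
  refine ⟨fun x => if h : x ∈ S then zc (c ⟨x, h⟩) - P (zc (c ⟨x, h⟩)) else 0, ?_, ?_⟩
  · intro x y h
    have hx := h.source_mem
    have hy := h.target_mem
    have := key ⟨x, hx⟩ ⟨y, hy⟩ 0 (by simpa [zc_zero] using h)
    simp only [hx, hy, dite_true]
    rw [this]; simp [zc_zero]
  · intro x v hx
    have hy := hper x v hx
    have := key ⟨x, hx⟩ ⟨x + zc v, hy⟩ v (JoinedIn.refl hy)
    simp only [hx, hy, dite_true]
    exact this

/-- A path from `x` to `x + v` yields a loop. -/
lemma exists_loop {d : ℕ} {S : Set (Fin d → ℝ)} (hper : ∀ x v, x ∈ S → x + zc v ∈ S)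
    {x : Fin d → ℝ} {v : Fin d → ℤ} (h : JoinedIn S x (x + zc v)) :
    ∃ γ : ℝ → (Fin d → ℝ), Continuous γ ∧ (∀ t, γ (t + 1) = γ t + zc v) ∧ ∀ t, γ t ∈ S := by
  obtain ⟨p, hp⟩ := h
  have hc : Continuous ((fun t : ℝ => p.extend t - t • zc v) ∘ Int.fract) := by
    apply ContinuousOn.comp_fract''
    · exact (p.continuous_extend.sub (continuous_id.smul continuous_const)).continuousOn
    · simp
  refine ⟨fun t => ((fun t : ℝ => p.extend t - t • zc v) ∘ Int.fract) t + t • zc v, ?_, ?_, ?_⟩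
  · exact hc.add (continuous_id.smul continuous_const)
  · intro t
    simp only [Function.comp, Int.fract_add_one, add_smul, one_smul, add_assoc]
  · intro t
    have e : ((fun t : ℝ => p.extend t - t • zc v) ∘ Int.fract) t + t • zc v
        = p.extend (Int.fract t) + zc (⌊t⌋ • v) := by
      rw [zc_zsmul]
      simp only [Function.comp]
      have : t • zc v = Int.fract t • zc v + (⌊t⌋ : ℝ) • zc v := by
        rw [← add_smul, Int.fract_add_floor]
      rw [this]; abel
    beta_reduce
    rw [e]
    apply hper
    rw [Path.extend_apply p ⟨Int.fract_nonneg t, (Int.fract_lt_one t).le⟩]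
    exact hp _

lemma exists_proj {d k : ℕ} (L : Set (Fin d → ℤ))
    (hL : ¬ ∃ v : Fin k → (Fin d → ℤ), (∀ l, v l ∈ L) ∧
      LinearIndependent ℚ (fun l => fun j => (v l j : ℚ))) :
    ∃ P : (Fin d → ℝ) →L[ℝ] (Fin d → ℝ),
      Module.finrank ℝ (LinearMap.range (P : (Fin d → ℝ) →ₗ[ℝ] (Fin d → ℝ))) < k ∧
      ∀ v ∈ L, P (zc v) = zc v := by
  classical
  obtain ⟨κ, a, ha, hspan, hli⟩ := exists_linearIndependent' ℚ
    (fun v : L => (fun j => ((v.1 j : ℤ) : ℚ) : Fin d → ℚ))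
  have hfin : Finite κ := hli.finite
  have := Fintype.ofFinite κ
  have hcard : Fintype.card κ < k := by
    by_contra! hk
    obtain ⟨e⟩ : Nonempty (Fin k ↪ κ) := by
      rw [Function.Embedding.nonempty_iff_card_le]; simpa using hk
    exact hL ⟨fun l => (a (e l)).1, fun l => (a (e l)).2, hli.comp e e.injective⟩
  set W : Submodule ℝ (Fin d → ℝ) := Submodule.span ℝ (Set.range fun i => zc (a i).1) with hW
  have hWr : Module.finrank ℝ W ≤ Fintype.card κ := finrank_range_le_card _
  have hmem : ∀ v ∈ L, zc v ∈ W := by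
    intro v hv
    have h1 : (fun j => ((v j : ℤ) : ℚ) : Fin d → ℚ) ∈ Submodule.span ℚ
        (Set.range ((fun v : L => (fun j => ((v.1 j : ℤ) : ℚ) : Fin d → ℚ)) ∘ a)) := by
      rw [hspan]
      exact Submodule.subset_span ⟨⟨v, hv⟩, rfl⟩
    have h2 : ∀ x ∈ Submodule.span ℚ
        (Set.range ((fun v : L => (fun j => ((v.1 j : ℤ) : ℚ) : Fin d → ℚ)) ∘ a)),
        (fun j => ((x j : ℚ) : ℝ)) ∈ W := by
      intro x hx
      induction hx using Submodule.span_induction with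
      | mem x hx =>
        obtain ⟨i, rfl⟩ := hx
        apply Submodule.subset_span
        refine ⟨i, ?_⟩
        ext j; simp [zc]
      | zero => convert W.zero_mem using 1; ext j; simp
      | add x y _ _ hx hy => convert W.add_mem hx hy using 1; ext j; simp
      | smul c x _ hx => convert W.smul_mem (c : ℝ) hx using 1; ext j; simp
    have := h2 _ h1
    convert this using 1
    ext j; simp [zc]
  obtain ⟨p, hp⟩ := W.subtype.exists_leftInverse_of_injective W.ker_subtype
  refine ⟨LinearMap.toContinuousLinearMap (W.subtype.comp p), ?_, ?_⟩
  · refine lt_of_le_of_lt ?_ hcard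
    refine le_trans (Submodule.finrank_mono (t := W) ?_) hWr
    rintro _ ⟨x, rfl⟩
    simp
  · intro v hv
    have := LinearMap.congr_fun hp ⟨zc v, hmem v hv⟩
    simp at this
    simp [this]

/-- smooth periodic bump functions -/
lemma exists_bump {d : ℕ} (S : Set (Fin d → ℝ)) (hS : IsOpen S)
    (hper : ∀ x v, x ∈ S → x + zc v ∈ S) (a : Fin d → ℝ) (ha : a ∈ S) :
    ∃ b : (Fin d → ℝ) → ℝ, ContDiff ℝ 1 b ∧ (∀ x v, b (x + zc v) = b x) ∧ (∀ x, 0 ≤ b x) ∧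
      0 < b a ∧ ∀ x, 0 < b x → x ∈ S := by
  obtain ⟨r, hr, hball⟩ := Metric.isOpen_iff.1 hS a ha
  refine ⟨fun x => expNegInvGlue (8 * r ^ 2 - ∑ j, (1 - Real.cos (2 * Real.pi * (x j - a j)))),
    ?_, ?_, fun x => expNegInvGlue.nonneg _, ?_, ?_⟩
  · refine (expNegInvGlue.contDiff (n := 1)).comp ?_
    fun_prop
  · intro x v
    beta_reduce
    congr 2
    refine Finset.sum_congr rfl fun j _ => ?_
    congr 1
    have : 2 * Real.pi * ((x + zc v) j - a j) = 2 * Real.pi * (x j - a j) + (v j : ℝ) * (2 * Real.pi) := by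
      simp [zc]; ring
    rw [this, Real.cos_add_int_mul_two_pi]
  · apply expNegInvGlue.pos_of_pos
    simp; positivity
  · intro x hx
    have hx' : ∑ j, (1 - Real.cos (2 * Real.pi * (x j - a j))) < 8 * r ^ 2 := by
      by_contra! h
      beta_reduce at hx
      rw [expNegInvGlue.zero_of_nonpos (by linarith)] at hx
      exact lt_irrefl _ hx
    have hj : ∀ j, |x j - a j - round (x j - a j)| < r := by
      intro j
      set u := x j - a j - round (x j - a j) with hu
      have hu2 : |u| ≤ 1 / 2 := abs_sub_round _
      have h1 : 1 - Real.cos (2 * Real.pi * (x j - a j)) ≤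
          ∑ j, (1 - Real.cos (2 * Real.pi * (x j - a j))) :=
        Finset.single_le_sum (f := fun j => 1 - Real.cos (2 * Real.pi * (x j - a j)))
          (fun j _ => by linarith [Real.cos_le_one (2 * Real.pi * (x j - a j))]) (Finset.mem_univ j)
      have h2 : Real.cos (2 * Real.pi * (x j - a j)) = Real.cos (2 * Real.pi * u) := by
        have : 2 * Real.pi * (x j - a j) = 2 * Real.pi * u + ((round (x j - a j) : ℤ) : ℝ) * (2 * Real.pi) := by
          rw [hu]; ring
        rw [this, Real.cos_add_int_mul_two_pi]
      have h3 : Real.cos (2 * Real.pi * u) ≤ 1 - 2 / Real.pi ^ 2 * (2 * Real.pi * u) ^ 2 := by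
        apply Real.cos_le_one_sub_mul_cos_sq
        rw [abs_mul, abs_of_pos (by positivity)]
        nlinarith [Real.pi_pos]
      have h4 : 2 / Real.pi ^ 2 * (2 * Real.pi * u) ^ 2 = 8 * u ^ 2 := by
        have := Real.pi_pos.ne'
        field_simp; ring
      have h5 : u ^ 2 < r ^ 2 := by linarith
      exact abs_lt_of_sq_lt_sq h5 hr.le
    have hmem : x + zc (fun j => - round (x j - a j)) ∈ S := by
      apply hball
      rw [Metric.mem_ball, dist_pi_lt_iff hr]
      intro j
      rw [Real.dist_eq]
      convert hj j using 2
      simp [zc]; ring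
    have := hper _ (fun j => round (x j - a j)) hmem
    rw [add_assoc, ← zc_add] at this
    convert this using 1
    ext j; simp [zc]

lemma exists_pou {d : ℕ} {I : Type} [Fintype I] (S : I → Set (Fin d → ℝ)) (hS : ∀ i, IsOpen (S i))
    (hper : ∀ i x v, x ∈ S i → x + zc v ∈ S i) (hcov : ∀ x, ∃ i, x ∈ S i) :
    ∃ f : I → (Fin d → ℝ) → ℝ, (∀ i, ContDiff ℝ 1 (f i)) ∧ (∀ i x v, f i (x + zc v) = f i x) ∧
      (∀ i x, 0 < f i x → x ∈ S i) ∧ ∀ x, ∃ i, 0 < f i x := by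
  classical
  choose c hc using hcov
  choose b hb1 hb2 hb3 hb4 hb5 using fun a => exists_bump (S (c a)) (hS _) (hper _) a (hc a)
  obtain ⟨t, -, ht⟩ := (isCompact_Icc (a := (0 : Fin d → ℝ)) (b := 1)).elim_nhds_subcover
    (fun a => {x | 0 < b a x})
    (fun a _ => (isOpen_lt continuous_const (hb1 a).continuous).mem_nhds (hb4 a))
  refine ⟨fun i x => ∑ a ∈ t with c a = i, b a x, ?_, ?_, ?_, ?_⟩
  · intro i
    exact ContDiff.sum fun a _ => hb1 a
  · intro i x v
    simp only [hb2]
  · intro i x hx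
    obtain ⟨a, ha, hax⟩ := Finset.exists_lt_of_sum_lt (s := t.filter (fun a => c a = i))
      (f := fun _ => (0 : ℝ)) (g := fun a => b a x) (by simpa using hx)
    rw [← (Finset.mem_filter.1 ha).2]
    exact hb5 a x hax
  · intro x
    obtain ⟨y, hy, v, rfl⟩ := exists_rep x
    have := ht hy
    simp only [mem_iUnion] at this
    obtain ⟨a, ha, hay⟩ := this
    refine ⟨c a, ?_⟩
    simp only [hb2]
    exact Finset.sum_pos' (fun a _ => hb3 a y) ⟨a, Finset.mem_filter.2 ⟨ha, rfl⟩, hay⟩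

/-- Reduction of a cover of multiplicity at most `m + 1` to `m + 1` colours. -/
lemma exists_colours {d m : ℕ} {I : Type} [Fintype I] (S : I → Set (Fin d → ℝ))
    (hS : ∀ i, IsOpen (S i))
    (hper : ∀ i x v, x ∈ S i → x + zc v ∈ S i) (hcov : ∀ x, ∃ i, x ∈ S i)
    (hmult : ∀ x, {i | x ∈ S i}.ncard ≤ m + 1) :
    ∃ (s : ℕ → (Fin d → ℝ) → ℝ) (κ : ℕ → (Fin d → ℝ) → I),
      (∀ j, ContDiff ℝ 1 (s j)) ∧ (∀ j x v, s j (x + zc v) = s j x) ∧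
      (∀ j x v, s j x ≠ 0 → κ j (x + zc v) = κ j x ∧ x ∈ S (κ j x)) ∧
      (∀ j x, (∀ᶠ y in 𝓝 x, s j y = 0) ∨ (x ∈ S (κ j x) ∧ ∀ᶠ y in 𝓝 x, κ j y = κ j x)) ∧
      ∀ x, ∃ j ≤ m, ∀ᶠ y in 𝓝 x, s j y = 1 := by
  classical
  obtain ⟨f, hf1, hf2, hf3, hf4⟩ := exists_pou S hS hper hcov
  obtain ⟨i0, -⟩ := hcov 0
  let e : Finset I → I := fun σ => if h : σ.Nonempty then h.choose else i0
  have he : ∀ σ : Finset I, σ.Nonempty → e σ ∈ σ := by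
    intro σ h
    simp only [e, h, dite_true]
    exact h.choose_spec
  let g : Finset I → (Fin d → ℝ) → ℝ := fun σ x =>
    (∏ i ∈ σ, expNegInvGlue (f i x)) *
      ∏ i ∈ σ, ∏ k ∈ σᶜ, expNegInvGlue (f i x - f k x)
  have hg1 : ∀ σ, ContDiff ℝ 1 (g σ) := by
    intro σ
    refine ContDiff.mul (contDiff_prod fun i _ => ?_)
      (contDiff_prod fun i _ => contDiff_prod fun k _ => ?_)
    · exact (expNegInvGlue.contDiff (n := 1)).comp (hf1 i)
    · exact (expNegInvGlue.contDiff (n := 1)).comp ((hf1 i).sub (hf1 k))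
  have hg2 : ∀ σ x v, g σ (x + zc v) = g σ x := by
    intro σ x v
    simp only [g, hf2]
  have hg3 : ∀ σ x, 0 ≤ g σ x := by
    intro σ x
    exact mul_nonneg (Finset.prod_nonneg fun i _ => expNegInvGlue.nonneg _)
      (Finset.prod_nonneg fun i _ => Finset.prod_nonneg fun k _ => expNegInvGlue.nonneg _)
  have hg4 : ∀ σ x, 0 < g σ x → (∀ i ∈ σ, 0 < f i x) ∧ ∀ i ∈ σ, ∀ k ∉ σ, f k x < f i x := by
    intro σ x h
    have h1 := left_ne_zero_of_mul h.ne'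
    have h2 := right_ne_zero_of_mul h.ne'
    rw [Finset.prod_ne_zero_iff] at h1 h2
    refine ⟨fun i hi => ?_, fun i hi k hk => ?_⟩
    · have := h1 i hi
      rwa [Ne, expNegInvGlue.zero_iff_nonpos, not_le] at this
    · have := Finset.prod_ne_zero_iff.1 (h2 i hi) k (Finset.mem_compl.2 hk)
      rw [Ne, expNegInvGlue.zero_iff_nonpos, not_le] at this
      linarith
  have hg5 : ∀ σ τ x, σ.card = τ.card → 0 < g σ x → 0 < g τ x → σ = τ := by
    intro σ τ x hc h1 h2
    by_contra hne
    have a1 : ¬ σ ⊆ τ := fun h => hne (Finset.eq_of_subset_of_card_le h hc.ge)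
    have a2 : ¬ τ ⊆ σ := fun h => hne (Finset.eq_of_subset_of_card_le h hc.le).symm
    obtain ⟨i, hi, hi'⟩ := Finset.not_subset.1 a1
    obtain ⟨k, hk, hk'⟩ := Finset.not_subset.1 a2
    have b1 := (hg4 σ x h1).2 i hi k hk'
    have b2 := (hg4 τ x h2).2 k hk i hi'
    linarith
  have hg6 : ∀ x, ∃ j ≤ m, ∃ σ : Finset I, σ.card = j + 1 ∧ 0 < g σ x := by
    intro x
    let σ : Finset I := Finset.univ.filter fun i => 0 < f i x
    have hne : 0 < σ.card := by
      obtain ⟨i, hi⟩ := hf4 x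
      exact Finset.card_pos.2 ⟨i, by simp [σ, hi]⟩
    have hle : σ.card ≤ m + 1 := by
      refine le_trans ?_ (hmult x)
      rw [← Set.ncard_coe_finset]
      refine Set.ncard_le_ncard ?_ (Set.toFinite _)
      intro i hi
      simp only [σ, Finset.coe_filter, Finset.mem_univ, true_and, mem_setOf_eq] at hi
      exact hf3 i x hi
    refine ⟨σ.card - 1, by omega, σ, by omega, ?_⟩
    refine mul_pos (Finset.prod_pos fun i hi => expNegInvGlue.pos_of_pos ?_)
      (Finset.prod_pos fun i hi => Finset.prod_pos fun k hk => expNegInvGlue.pos_of_pos ?_)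
    · exact (Finset.mem_filter.1 hi).2
    · have h1 := (Finset.mem_filter.1 hi).2
      have h2 : ¬ 0 < f k x := by simpa [σ] using hk
      linarith
  let G : ℕ → (Fin d → ℝ) → ℝ := fun j x => ∑ σ with σ.card = j + 1, g σ x
  have hG1 : ∀ j, ContDiff ℝ 1 (G j) := fun j => ContDiff.sum fun σ _ => hg1 σ
  have hG2 : ∀ j x v, G j (x + zc v) = G j x := by
    intro j x v
    simp only [G, hg2]
  have hG3 : ∀ j x, 0 ≤ G j x := fun j x => Finset.sum_nonneg fun σ _ => hg3 σ x
  have hG4 : ∀ j x, 0 < G j x → ∃ σ : Finset I, σ.card = j + 1 ∧ 0 < g σ x := by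
    intro j x hx
    obtain ⟨σ, hσ, h⟩ := Finset.exists_lt_of_sum_lt
      (s := Finset.univ.filter (fun σ : Finset I => σ.card = j + 1))
      (f := fun _ => (0 : ℝ)) (g := fun σ => g σ x) (by rw [Finset.sum_const_zero]; exact hx)
    exact ⟨σ, (Finset.mem_filter.1 hσ).2, h⟩
  have hG5 : ∀ x, 0 < ∑ j ∈ Finset.range (m + 1), G j x := by
    intro x
    obtain ⟨j, hj, σ, hσ, h⟩ := hg6 x
    refine Finset.sum_pos' (fun j _ => hG3 j x) ⟨j, Finset.mem_range.2 (by omega), ?_⟩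
    exact Finset.sum_pos' (fun σ _ => hg3 σ x) ⟨σ, by simp [hσ], h⟩
  obtain ⟨ε, hε, hG6⟩ : ∃ ε > 0, ∀ x, ∃ j ≤ m, ε ≤ G j x := by
    have hcont : Continuous fun x => ∑ j ∈ Finset.range (m + 1), G j x :=
      continuous_finsetSum _ fun j _ => (hG1 j).continuous
    obtain ⟨x0, -, hx0⟩ := (isCompact_Icc (a := (0 : Fin d → ℝ)) (b := 1)).exists_isMinOn
      ⟨0, by simp⟩ hcont.continuousOn
    refine ⟨(∑ j ∈ Finset.range (m + 1), G j x0) / (m + 1), div_pos (hG5 x0) (by positivity), ?_⟩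
    intro x
    obtain ⟨y, hy, v, rfl⟩ := exists_rep x
    have hmin : ∑ j ∈ Finset.range (m + 1), G j x0 ≤ ∑ j ∈ Finset.range (m + 1), G j y := hx0 hy
    obtain ⟨j, hj, h⟩ := Finset.exists_le_of_sum_le (s := Finset.range (m + 1))
      (f := fun _ => (∑ j ∈ Finset.range (m + 1), G j x0) / ((m : ℝ) + 1)) (g := fun j => G j y)
      ⟨0, by simp⟩ (by
        rw [Finset.sum_const, Finset.card_range, nsmul_eq_mul]
        push_cast
        rw [mul_div_cancel₀ _ (by positivity)]
        exact hmin)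
    refine ⟨j, by have := Finset.mem_range.1 hj; omega, ?_⟩
    rw [hG2]; exact h
  let κ : ℕ → (Fin d → ℝ) → I := fun j x =>
    if h : ∃ σ : Finset I, σ.card = j + 1 ∧ 0 < g σ x then e h.choose else i0
  have hκ : ∀ j x (σ : Finset I), σ.card = j + 1 → 0 < g σ x → κ j x = e σ := by
    intro j x σ h1 h2
    have h : ∃ σ : Finset I, σ.card = j + 1 ∧ 0 < g σ x := ⟨σ, h1, h2⟩
    have h3 : κ j x = e h.choose := by simp only [κ, h, dite_true]
    rw [h3, hg5 h.choose σ x (by rw [h.choose_spec.1, h1]) h.choose_spec.2 h2]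
  have hκS : ∀ j x (σ : Finset I), σ.card = j + 1 → 0 < g σ x → x ∈ S (κ j x) := by
    intro j x σ h1 h2
    rw [hκ j x σ h1 h2]
    exact hf3 _ _ ((hg4 σ x h2).1 _ (he σ (Finset.card_pos.1 (by omega))))
  have hsz : ∀ j x, G j x ≤ ε / 3 → Real.smoothTransition (3 / ε * G j x - 1) = 0 := by
    intro j x h
    apply Real.smoothTransition.zero_of_nonpos
    have : 3 / ε * G j x ≤ 3 / ε * (ε / 3) := by gcongr
    have h2 : 3 / ε * (ε / 3) = 1 := by field_simp
    linarith
  refine ⟨fun j x => Real.smoothTransition (3 / ε * G j x - 1), κ, ?_, ?_, ?_, ?_, ?_⟩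
  · intro j
    exact (Real.smoothTransition.contDiff (n := 1)).comp
      ((contDiff_const.mul (hG1 j)).sub contDiff_const)
  · intro j x v
    simp only [hG2]
  · intro j x v hx
    have hpos : 0 < G j x := by
      by_contra! h
      exact hx (hsz j x (h.trans (by positivity)))
    obtain ⟨σ, h1, h2⟩ := hG4 j x hpos
    refine ⟨?_, hκS j x σ h1 h2⟩
    rw [hκ j x σ h1 h2, hκ j _ σ h1 (by rwa [hg2])]
  · intro j x
    rcases (hG3 j x).eq_or_lt with h | h
    · left
      have : ∀ᶠ y in 𝓝 x, G j y < ε / 3 :=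
        (hG1 j).continuous.continuousAt.eventually_lt continuousAt_const (by rw [← h]; positivity)
      filter_upwards [this] with y hy
      exact hsz j y hy.le
    · right
      obtain ⟨σ, h1, h2⟩ := hG4 j x h
      refine ⟨hκS j x σ h1 h2, ?_⟩
      have : ∀ᶠ y in 𝓝 x, 0 < g σ y :=
        continuousAt_const.eventually_lt (hg1 σ).continuous.continuousAt h2
      filter_upwards [this] with y hy
      rw [hκ j x σ h1 h2, hκ j y σ h1 hy]
  · intro x
    obtain ⟨j, hj, h⟩ := hG6 x
    refine ⟨j, hj, ?_⟩
    have : ∀ᶠ y in 𝓝 x, 2 * ε / 3 < G j y :=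
      continuousAt_const.eventually_lt (hG1 j).continuous.continuousAt (by linarith)
    filter_upwards [this] with y hy
    apply Real.smoothTransition.one_of_one_le
    have h1 : 3 / ε * (2 * ε / 3) ≤ 3 / ε * G j y := by gcongr
    have h2 : 3 / ε * (2 * ε / 3) = 2 := by field_simp
    linarith

lemma main_aux (d m : ℕ) (hm : m < d)
    (I : Type) [Fintype I] (S : I → Set (Fin d → ℝ))
    (hS : ∀ i, IsOpen (S i))
    (hper : ∀ i x v, x ∈ S i → x + zc v ∈ S i) (hcov : ∀ x, ∃ i, x ∈ S i)
    (hmult : ∀ x, {i | x ∈ S i}.ncard ≤ m + 1) :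
    ∃ i : I, ∃ v : Fin (d - m) → (Fin d → ℤ), (∀ l, ∃ x, JoinedIn (S i) x (x + zc (v l))) ∧
      LinearIndependent ℚ (fun l => fun j => (v l j : ℚ)) := by
  by_contra! hcon
  have hproj : ∀ i, ∃ P : (Fin d → ℝ) →L[ℝ] (Fin d → ℝ),
      Module.finrank ℝ (LinearMap.range (P : (Fin d → ℝ) →ₗ[ℝ] (Fin d → ℝ))) < d - m ∧
      ∀ v ∈ {v | ∃ x, JoinedIn (S i) x (x + zc v)}, P (zc v) = zc v := by
    intro i
    apply exists_proj
    rintro ⟨v, hv, hli⟩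
    exact hcon i v hv hli
  choose P hP1 hP2 using hproj
  choose q hq1 hq2 using fun i => exists_offset (S i) (hper i) (P i)
    (fun x v h => hP2 i v ⟨x, h⟩)
  obtain ⟨s, κ, hs1, hs2, hs3, hs4, hs5⟩ := exists_colours S hS hper hcov hmult
  refine core (d := d) (m := m) s (fun j x => P (κ j x)) (fun j x => q (κ j x) x) hs1 hs2 ?_ ?_ ?_ hs5
  · intro j x
    rcases hs4 j x with h | ⟨hx, h⟩
    · exact Or.inl h
    · right
      refine ⟨P (κ j x), q (κ j x) x, ?_⟩
      obtain ⟨r, hr, hball⟩ := Metric.isOpen_iff.1 (hS (κ j x)) x hx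
      filter_upwards [h, Metric.ball_mem_nhds x hr] with y hy hyr
      rw [hy]
      refine ⟨rfl, ?_⟩
      apply hq1
      have hpc : IsPathConnected (Metric.ball x r) :=
        (convex_ball x r).isPathConnected ⟨x, Metric.mem_ball_self hr⟩
      exact (hpc.joinedIn y hyr x (Metric.mem_ball_self hr)).mono hball
  · intro j x v hx
    obtain ⟨h1, h2⟩ := hs3 j x v hx
    simp only [h1]
    exact ⟨trivial, hq2 _ x v h2⟩
  · intro j x
    have := hP1 (κ j x)
    omega

end TorusCover



/-- **Covering corollary for the torus** (Matdinov, Corollary 2). Let `d ≥ 1`,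
`0 ≤ m ≤ d`, and let `(C_i)_{i∈I}` be a finite family of open subsets of the torus
`T^d = (ℝ/ℤ)^d` covering the torus, such that every point belongs to at most `m+1` of
the sets.  Then for some index `i` the image of `H_1(C_i)` in `H_1(T^d) = ℤ^d` has rank
at least `d−m`: concretely, there are `d−m` loops in `C_i`, encoded by continuous lifts
`γ_l : ℝ → ℝ^d` with `γ_l(t+1) = γ_l(t) + v_l` for integer vectors `v_l ∈ ℤ^d` and with
projections lying in `C_i`, whose classes `v_1, …, v_{d−m}` are linearly independent
over `ℚ`. -/
theorem torus_cover_large_one_dimensional_homology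
    (d m : ℕ) (hd : 1 ≤ d) (hm : m ≤ d)
    (I : Type) [Fintype I] (C : I → Set (Fin d → AddCircle (1 : ℝ)))
    (hopen : ∀ i, IsOpen (C i))
    (hcover : ∀ x, ∃ i, x ∈ C i)
    (hmult : ∀ x, {i | x ∈ C i}.ncard ≤ m + 1) :
    ∃ i : I, ∃ γ : Fin (d - m) → ℝ → (Fin d → ℝ), ∃ v : Fin (d - m) → (Fin d → ℤ),
      (∀ l, Continuous (γ l)) ∧
      (∀ l t, γ l (t + 1) = γ l t + fun j => (v l j : ℝ)) ∧
      (∀ l t, (fun j => ((γ l t j : ℝ) : AddCircle (1 : ℝ))) ∈ C i) ∧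
      LinearIndependent ℚ (fun l => fun j => (v l j : ℚ)) := by
  rcases hm.eq_or_lt with rfl | hlt
  · obtain ⟨i, -⟩ := hcover 0
    have hemp : IsEmpty (Fin (m - m)) := by rw [Nat.sub_self]; infer_instance
    exact ⟨i, fun _ _ => 0, fun _ => 0, fun l => isEmptyElim l, fun l => isEmptyElim l,
      fun l => isEmptyElim l, linearIndependent_empty_type⟩
  set pr : (Fin d → ℝ) → (Fin d → AddCircle (1 : ℝ)) :=
    fun x j => ((x j : ℝ) : AddCircle (1 : ℝ)) with hpr
  have hprc : Continuous pr :=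
    continuous_pi fun j => (AddCircle.continuous_mk' 1).comp (continuous_apply j)
  have hprz : ∀ x v, pr (x + TorusCover.zc v) = pr x := by
    intro x v
    ext j
    have h1 : (((v j : ℤ) : ℝ) : AddCircle (1 : ℝ)) = 0 :=
      (AddCircle.coe_eq_zero_iff 1).2 ⟨v j, by simp⟩
    simp only [hpr, TorusCover.zc, Pi.add_apply, AddCircle.coe_add, h1, add_zero]
  have hper : ∀ i x v, x ∈ pr ⁻¹' (C i) → x + TorusCover.zc v ∈ pr ⁻¹' (C i) := by
    intro i x v hx
    rw [Set.mem_preimage, hprz]; exact hx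
  obtain ⟨i, v, hv, hli⟩ := TorusCover.main_aux d m hlt I (fun i => pr ⁻¹' (C i))
    (fun i => (hopen i).preimage hprc) hper (fun x => hcover (pr x)) (fun x => hmult (pr x))
  choose x hx using hv
  choose γ h1 h2 h3 using fun l => TorusCover.exists_loop (hper i) (hx l)
  exact ⟨i, γ, v, h1, h2, h3, hli⟩
end
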